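/- Let α, β ∈ ℂ satisfy −Q/2 < Im α < 0, −Q/2 < Im β < 0 and Im(α + β) < −Q/2, and let u, v ∈ ℝ. Set α⋆ = −iQ/2 − α and β⋆ = −iQ/2 − β. Then ∫_ℝ exp(2πi(α⋆+β⋆)x)·D_α(x−u)·D_β(x−v) dx = w_b(2α + iQ/2)·w_b(2β + iQ/2)·w_b(−2(α+β) − 3iQ/2)·exp(2πi(v·α⋆ + u·β⋆))·D_{α+β+iQ/2}(u−v), the integral on the left converging absolutely. -/

import Mathlib

open MeasureTheory

/-- The non-compact quantum dilogarithm `w_b`. -/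
noncomputable def wb (b ε : ℝ) (z : ℂ) : ℂ :=
  Complex.exp (Complex.I * ((Real.pi : ℝ) : ℂ) / 2 * z ^ 2 +
    Complex.I * ((Real.pi : ℝ) : ℂ) / 24 * ((b : ℂ) ^ 2 + ((b : ℂ))⁻¹ ^ 2) -
    ∫ t : ℝ,
      Complex.exp (-(2 * Complex.I * ((t : ℂ) + Complex.I * (ε : ℂ)) * z)) /
        (4 * ((t : ℂ) + Complex.I * (ε : ℂ)) *
          Complex.sinh ((b : ℂ) * ((t : ℂ) + Complex.I * (ε : ℂ))) *
          Complex.sinh (((t : ℂ) + Complex.I * (ε : ℂ)) / (b : ℂ))))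

/-- The function `D_α`. -/
noncomputable def Dfun (b ε : ℝ) (α z : ℂ) : ℂ :=
  Complex.exp (Complex.I *
    ∫ t : ℝ,
      Complex.cos (2 * ((t : ℂ) + Complex.I * (ε : ℂ)) * z) *
          Complex.sin (2 * α * ((t : ℂ) + Complex.I * (ε : ℂ))) /
        (2 * ((t : ℂ) + Complex.I * (ε : ℂ)) *
          Complex.sinh ((b : ℂ) * ((t : ℂ) + Complex.I * (ε : ℂ))) *
          Complex.sinh (((t : ℂ) + Complex.I * (ε : ℂ)) / (b : ℂ))))

namespace QD

open Filter Topology Set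

lemma integrable_exp_neg_abs {c : ℝ} (hc : 0 < c) :
    Integrable (fun t : ℝ => Real.exp (-(c * |t|))) := by
  rw [← integrableOn_univ, ← Iic_union_Ioi (a := (0:ℝ)), integrableOn_union]
  constructor
  · have h := integrableOn_exp_mul_Iic hc 0
    refine h.congr_fun (fun x hx => ?_) measurableSet_Iic
    simp only [abs_of_nonpos hx.out]; ring_nf
  · have h := integrableOn_exp_mul_Ioi (neg_lt_zero.2 hc) 0
    refine h.congr_fun (fun x hx => ?_) measurableSet_Ioi
    simp only [abs_of_pos hx.out]; ring_nf

lemma hasDerivAt_param {U : Set ℂ} (hU : IsOpen U) (f : ℂ → ℝ → ℂ)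
    (hd : ∀ t, DifferentiableOn ℂ (fun z => f z t) U)
    (hm : ∀ z ∈ U, AEStronglyMeasurable (f z) volume)
    {z₀ : ℂ} (hz : z₀ ∈ U)
    (hb : ∃ r > 0, ∃ g : ℝ → ℝ, Integrable g ∧
      ∀ z ∈ U, ‖z - z₀‖ ≤ r → ∀ t, ‖f z t‖ ≤ g t) :
    HasDerivAt (fun z => ∫ t, f z t) (∫ t, deriv (fun z => f z t) z₀) z₀ := by
  obtain ⟨r1, hr1, g, hg, hfg⟩ := hb
  obtain ⟨r2, hr2, hball⟩ := Metric.isOpen_iff.1 hU z₀ hz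
  set r := min r1 r2 with hr
  have hr0 : 0 < r := lt_min hr1 hr2
  have hsub : ∀ z, ‖z - z₀‖ < r → z ∈ U := fun z hz' => hball (by
    rw [Metric.mem_ball, dist_eq_norm]; exact hz'.trans_le (min_le_right _ _))
  have hbd : ∀ z, ‖z - z₀‖ < r → ∀ t, ‖f z t‖ ≤ g t := fun z hz' t =>
    hfg z (hsub z hz') (hz'.le.trans (min_le_left _ _)) t
  have hs : Metric.ball z₀ (r/2) ∈ 𝓝 z₀ := Metric.ball_mem_nhds _ (by positivity)
  have hda : ∀ t z, ‖z - z₀‖ < r → HasDerivAt (fun z => f z t) (deriv (fun z => f z t) z) z :=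
    fun t z hz' => ((hd t).differentiableAt (hU.mem_nhds (hsub z hz'))).hasDerivAt
  refine (hasDerivAt_integral_of_dominated_loc_of_deriv_le (F := f)
    (F' := fun z t => deriv (fun z => f z t) z) (bound := fun t => g t / (r/4)) hs ?_ ?_ ?_ ?_ ?_ ?_).2
  · filter_upwards [hU.mem_nhds hz] with z hz' using hm z hz'
  · exact hg.mono' (hm z₀ hz) (Eventually.of_forall fun t => hbd z₀ (by simpa using hr0) t)
  · have hu : Tendsto (fun n : ℕ => z₀ + ((r / (n + 2) : ℝ) : ℂ)) atTop (𝓝[≠] z₀) := by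
      refine tendsto_nhdsWithin_iff.2 ⟨?_, Eventually.of_forall fun n => ?_⟩
      · have h1 : Tendsto (fun n : ℕ => r / ((n:ℝ) + 2)) atTop (𝓝 0) :=
          tendsto_const_nhds.div_atTop (tendsto_atTop_add_const_right _ _ tendsto_natCast_atTop_atTop)
        have h2 := (Complex.continuous_ofReal.tendsto 0).comp h1
        simpa using h2.const_add z₀
      · have : r / ((n:ℝ) + 2) ≠ 0 := by positivity
        intro h
        have h' : ((r / ((n:ℝ) + 2) : ℝ) : ℂ) = 0 := by simpa using h
        exact this (by exact_mod_cast h')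
    refine aestronglyMeasurable_of_tendsto_ae (u := atTop)
      (f := fun (n : ℕ) t => slope (fun z => f z t) z₀ (z₀ + ((r / (n + 2) : ℝ) : ℂ))) ?_ ?_
    · intro n
      have hmem : z₀ + ((r / (n + 2) : ℝ) : ℂ) ∈ U := by
        apply hsub
        rw [add_sub_cancel_left, Complex.norm_real, Real.norm_of_nonneg (by positivity)]
        rw [div_lt_iff₀ (by positivity)]
        nlinarith [(Nat.cast_nonneg n : (0:ℝ) ≤ n)]
      simp only [slope, vsub_eq_sub]
      exact ((hm _ hmem).sub (hm _ hz)).const_smul ((z₀ + ((r / (n + 2) : ℝ) : ℂ) - z₀)⁻¹)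
    · refine Eventually.of_forall fun t => ?_
      have := (hasDerivAt_iff_tendsto_slope.1 (hda t z₀ (by simpa using hr0)))
      exact this.comp hu
  · refine Eventually.of_forall fun t z hz' => ?_
    rw [Metric.mem_ball, dist_eq_norm] at hz'
    have key : ∀ w, ‖w - z‖ ≤ r/4 → ‖w - z₀‖ < r := fun w hw => by
      have := norm_sub_le_norm_sub_add_norm_sub w z z₀
      linarith
    refine Complex.norm_deriv_le_of_forall_mem_sphere_norm_le (by positivity) ?_ ?_
    · refine DifferentiableOn.diffContOnCl ?_
      rw [closure_ball _ (by positivity)]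
      refine (hd t).mono fun w hw => hsub w (key w ?_)
      simpa [dist_eq_norm] using hw
    · intro w hw
      exact hbd w (key w (by simpa [dist_eq_norm] using hw.le)) t
  · exact hg.div_const _
  · refine Eventually.of_forall fun t z hz' => hda t z ?_
    rw [Metric.mem_ball, dist_eq_norm] at hz'
    linarith

/-- shifting a contour -/
lemma shift_tendsto {y1 y2 : ℝ} (h12 : y1 ≤ y2) (g : ℂ → ℂ)
    (hg : ∀ z : ℂ, y1 ≤ z.im → z.im ≤ y2 → DifferentiableAt ℂ g z)
    (B : ℝ → ℝ) (hB : Tendsto B atTop (𝓝 0))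
    (hbd : ∀ᶠ R : ℝ in atTop, ∀ y, y1 ≤ y → y ≤ y2 →
      ‖g ((R:ℂ) + y * Complex.I)‖ ≤ B R ∧ ‖g (((-R : ℝ):ℂ) + y * Complex.I)‖ ≤ B R) :
    Tendsto (fun R : ℝ => (∫ x : ℝ in (-R)..R, g (x + y2 * Complex.I)) -
      ∫ x : ℝ in (-R)..R, g (x + y1 * Complex.I)) atTop (𝓝 0) := by
  have hlim : Tendsto (fun R => 2 * (B R * |y2 - y1|)) atTop (𝓝 0) := by
    simpa using (hB.mul_const _).const_mul 2
  refine squeeze_zero_norm' ?_ hlim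
  filter_upwards [hbd] with R hR
  have h := Complex.integral_boundary_rect_eq_zero_of_differentiableOn g
    (⟨-R, y1⟩ : ℂ) (⟨R, y2⟩ : ℂ) (fun z hz => by
      obtain ⟨_, h2⟩ := hz
      have h2' : z.im ∈ uIcc y1 y2 := h2
      rw [uIcc_of_le h12] at h2'
      exact (hg z h2'.1 h2'.2).differentiableWithinAt)
  simp only at h
  have e : ((∫ x : ℝ in (-R)..R, g (x + y2 * Complex.I)) -
      ∫ x : ℝ in (-R)..R, g (x + y1 * Complex.I)) =
      Complex.I • (∫ y : ℝ in y1..y2, g ((R:ℂ) + y * Complex.I)) -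
      Complex.I • (∫ y : ℝ in y1..y2, g (((-R:ℝ):ℂ) + y * Complex.I)) := by
    linear_combination -h
  rw [e]
  have b1 : ‖∫ y : ℝ in y1..y2, g ((R:ℂ) + y * Complex.I)‖ ≤ B R * |y2 - y1| :=
    intervalIntegral.norm_integral_le_of_norm_le_const fun y hy => by
      rw [uIoc_of_le h12] at hy
      exact (hR y hy.1.le hy.2).1
  have b2 : ‖∫ y : ℝ in y1..y2, g (((-R:ℝ):ℂ) + y * Complex.I)‖ ≤ B R * |y2 - y1| :=
    intervalIntegral.norm_integral_le_of_norm_le_const fun y hy => by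
      rw [uIoc_of_le h12] at hy
      exact (hR y hy.1.le hy.2).2
  refine (norm_sub_le _ _).trans ?_
  simp only [norm_smul, Complex.norm_I, one_mul]
  linarith

lemma tendsto_int_sym {f : ℝ → ℂ} (hf : Integrable f) :
    Tendsto (fun R : ℝ => ∫ x : ℝ in (-R)..R, f x) atTop (𝓝 (∫ x, f x)) :=
  intervalIntegral_tendsto_integral hf tendsto_neg_atTop_atBot tendsto_id

lemma tendsto_inv_line {y : ℝ} (hy : 0 < y) :
    Tendsto (fun R : ℝ => ∫ x : ℝ in (-R)..R, ((x:ℂ) + y * Complex.I)⁻¹) atTop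
      (𝓝 (-(Real.pi * Complex.I))) := by
  have hne : ∀ x : ℝ, (x:ℂ) + y * Complex.I ≠ 0 := fun x h => by
    have := congrArg Complex.im h; simp at this; exact hy.ne' this
  have hne' : ∀ x : ℝ, -(x:ℂ) + y * Complex.I ≠ 0 := fun x h => by
    have := congrArg Complex.im h; simp at this; exact hy.ne' this
  have hc : Continuous fun x : ℝ => ((x:ℂ) + y * Complex.I)⁻¹ :=
    Continuous.inv₀ (by fun_prop) hne
  have hc' : Continuous fun x : ℝ => (-(x:ℂ) + y * Complex.I)⁻¹ :=
    Continuous.inv₀ (by fun_prop) hne'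
  have e : ∀ R : ℝ, ∫ x : ℝ in (-R)..R, ((x:ℂ) + y * Complex.I)⁻¹ =
      -Complex.I * ((∫ x : ℝ in (-R)..R, y⁻¹ * (1 + (x / y)^2)⁻¹ : ℝ) : ℂ) := by
    intro R
    have h1 : ∫ x : ℝ in (-R)..R, ((x:ℂ) + y * Complex.I)⁻¹ =
        ∫ x : ℝ in (-R)..R, (-(x:ℂ) + y * Complex.I)⁻¹ := by
      have := intervalIntegral.integral_comp_neg (a := -R) (b := R)
        (fun x : ℝ => ((x:ℂ) + y * Complex.I)⁻¹)
      simp only [neg_neg] at this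
      rw [← this]; simp
    have h2 : ∫ x : ℝ in (-R)..R, ((x:ℂ) + y * Complex.I)⁻¹ =
        (1/2) * ((∫ x : ℝ in (-R)..R, ((x:ℂ) + y * Complex.I)⁻¹) +
        ∫ x : ℝ in (-R)..R, (-(x:ℂ) + y * Complex.I)⁻¹) := by rw [← h1]; ring
    rw [h2, ← intervalIntegral.integral_add (hc.intervalIntegrable _ _) (hc'.intervalIntegrable _ _),
      ← intervalIntegral.integral_const_mul, ← intervalIntegral.integral_ofReal,
      ← intervalIntegral.integral_const_mul]
    refine intervalIntegral.integral_congr fun x _ => ?_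
    have hne2 : (1 + ((x:ℂ) / y)^2) ≠ 0 := by
      have : (1 + (x/y)^2 : ℝ) ≠ 0 := by positivity
      exact_mod_cast this
    have hy' : (y:ℂ) ≠ 0 := by exact_mod_cast hy.ne'
    have hne3 : (x:ℂ)^2 + y^2 ≠ 0 := by
      have : (x^2 + y^2 : ℝ) ≠ 0 := by positivity
      exact_mod_cast this
    have e1 : (1 + ((x:ℂ) / y)^2) = (x^2 + y^2) / y^2 := by field_simp; ring
    push_cast
    rw [e1, inv_div]
    have := hne x; have := hne' x
    rw [inv_add_inv (hne x) (hne' x), show ((x:ℂ) + y * Complex.I) * (-(x:ℂ) + y * Complex.I) = -(x^2+y^2) by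
      linear_combination (y:ℂ)^2 * Complex.I_sq]
    field_simp
    ring
  simp only [e]
  have hi : Integrable (fun x : ℝ => y⁻¹ * (1 + (x / y)^2)⁻¹) :=
    (integrable_inv_one_add_sq.comp_div hy.ne').const_mul _
  have h1 := intervalIntegral_tendsto_integral hi tendsto_neg_atTop_atBot tendsto_id
  have h2 : ∫ x : ℝ, y⁻¹ * (1 + (x / y)^2)⁻¹ = Real.pi := by
    rw [integral_const_mul, Measure.integral_comp_div (fun x : ℝ => (1 + x^2)⁻¹),
      integral_univ_inv_one_add_sq, abs_of_pos hy, smul_eq_mul]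
    field_simp
  rw [h2] at h1
  have h3 := ((Complex.continuous_ofReal.tendsto _).comp h1).const_mul (-Complex.I)
  rw [show -(Real.pi * Complex.I) = -Complex.I * (Real.pi : ℂ) by ring]
  exact h3

lemma tendsto_inv_line' {y : ℝ} (hy : y < 0) :
    Tendsto (fun R : ℝ => ∫ x : ℝ in (-R)..R, ((x:ℂ) + y * Complex.I)⁻¹) atTop
      (𝓝 (Real.pi * Complex.I)) := by
  have h := (tendsto_inv_line (neg_pos.2 hy)).neg
  rw [neg_neg] at h
  refine h.congr fun R => ?_
  have := intervalIntegral.integral_comp_neg (a := -R) (b := R)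
        (fun x : ℝ => ((x:ℂ) + y * Complex.I)⁻¹)
  simp only [neg_neg] at this
  rw [← this, ← intervalIntegral.integral_neg]
  refine intervalIntegral.integral_congr fun x _ => ?_
  rw [← inv_neg]; push_cast; ring_nf

lemma tendsto_inv3_line {y : ℝ} (hy : y ≠ 0) :
    Tendsto (fun R : ℝ => ∫ x : ℝ in (-R)..R, ((x:ℂ) + y * Complex.I)⁻¹ ^ 3) atTop
      (𝓝 0) := by
  have hne : ∀ x : ℝ, (x:ℂ) + y * Complex.I ≠ 0 := fun x h => by
    have := congrArg Complex.im h; simp at this; exact hy this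
  have hc : Continuous fun x : ℝ => ((x:ℂ) + y * Complex.I)⁻¹ ^ 3 :=
    (Continuous.inv₀ (by fun_prop) hne).pow 3
  have e : ∀ R : ℝ, ∫ x : ℝ in (-R)..R, ((x:ℂ) + y * Complex.I)⁻¹ ^ 3 =
      -(1/2) * ((R:ℂ) + y * Complex.I)⁻¹ ^ 2 - -(1/2) * (((-R:ℝ):ℂ) + y * Complex.I)⁻¹ ^ 2 := by
    intro R
    refine intervalIntegral.integral_eq_sub_of_hasDerivAt
      (f := fun x : ℝ => -(1/2) * ((x:ℂ) + y * Complex.I)⁻¹ ^ 2) (fun x _ => ?_)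
      (hc.intervalIntegrable _ _)
    have h1 : HasDerivAt (fun x : ℝ => (x:ℂ) + y * Complex.I) 1 x :=
      (Complex.ofRealCLM.hasDerivAt (x := x)).add_const _
    have h2 := ((h1.fun_inv (hne x)).fun_pow 2).const_mul (-(1/2) : ℂ)
    refine h2.congr_deriv ?_
    have := hne x
    rw [show (2 - 1 : ℕ) = 1 from rfl, pow_one]
    push_cast
    field_simp
  simp only [e]
  have hb : ∀ R : ℝ, 0 < R → ‖-(1/2) * ((R:ℂ) + y * Complex.I)⁻¹ ^ 2 - -(1/2) * (((-R:ℝ):ℂ) + y * Complex.I)⁻¹ ^ 2‖ ≤ R⁻¹ ^ 2 := by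
    intro R hR
    have n1 : R ≤ ‖(R:ℂ) + y * Complex.I‖ := by
      have := Complex.abs_re_le_norm ((R:ℂ) + y * Complex.I); simp at this
      exact (le_abs_self R).trans this
    have n2 : R ≤ ‖((-R:ℝ):ℂ) + y * Complex.I‖ := by
      have := Complex.abs_re_le_norm (((-R:ℝ):ℂ) + y * Complex.I); simp at this
      simpa using (le_abs_self R).trans this
    have m1 : ‖(R:ℂ) + y * Complex.I‖⁻¹ ^ 2 ≤ R⁻¹ ^ 2 := by gcongr
    have m2 : ‖((-R:ℝ):ℂ) + y * Complex.I‖⁻¹ ^ 2 ≤ R⁻¹ ^ 2 := by gcongr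
    refine (norm_sub_le _ _).trans ?_
    simp only [norm_mul, norm_pow, norm_inv, norm_neg, norm_div, norm_one, Complex.norm_ofNat]
    linarith
  refine squeeze_zero_norm' (eventually_gt_atTop 0 |>.mono fun R hR => hb R hR) ?_
  simpa using (tendsto_inv_atTop_zero (𝕜 := ℝ)).pow 2

/-- residue lemma -/
lemma contour_residue {e n : ℝ} (he : 0 < e) (hn : 0 < n) (f : ℂ → ℂ) (q r : ℂ)
    (hf : ∀ z : ℂ, z ≠ 0 → -n ≤ z.im → z.im ≤ e → DifferentiableAt ℂ f z)
    (hlim : Tendsto (fun z => z * (f z - q * z⁻¹ ^ 3 - r * z⁻¹)) (𝓝[≠] 0) (𝓝 0))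
    (B : ℝ → ℝ) (hB : Tendsto B atTop (𝓝 0))
    (hbd : ∀ᶠ R : ℝ in atTop, ∀ y, -n ≤ y → y ≤ e →
      ‖f ((R:ℂ) + y * Complex.I)‖ ≤ B R ∧ ‖f (((-R : ℝ):ℂ) + y * Complex.I)‖ ≤ B R)
    (hi1 : Integrable fun t : ℝ => f (t + e * Complex.I))
    (hi2 : Integrable fun t : ℝ => f (t + (-n : ℝ) * Complex.I)) :
    (∫ t : ℝ, f (t + e * Complex.I)) - (∫ t : ℝ, f (t + (-n : ℝ) * Complex.I)) =
      -(2 * Real.pi * Complex.I * r) := by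
  set g : ℂ → ℂ := fun z => f z - q * z⁻¹ ^ 3 - r * z⁻¹ with hg
  have hgd : ∀ z : ℂ, z ≠ 0 → -n ≤ z.im → z.im ≤ e → DifferentiableAt ℂ g z := by
    intro z hz h1 h2
    exact ((hf z hz h1 h2).sub (((differentiableAt_inv hz).pow 3).const_mul q)).sub
      ((differentiableAt_inv hz).const_mul r)
  let S : Set ℂ := {z | -n < z.im ∧ z.im < e}
  have hS : IsOpen S := (isOpen_lt continuous_const Complex.continuous_im).inter
    (isOpen_lt Complex.continuous_im continuous_const)
  have hS0 : S ∈ 𝓝 (0:ℂ) := hS.mem_nhds (by simp [S, he, hn])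
  have ho : (fun z => g z - g 0) =o[𝓝[≠] 0] fun z : ℂ => (z - 0)⁻¹ := by
    rw [Asymptotics.isLittleO_iff_tendsto']
    · have h0 : Tendsto (fun z : ℂ => z * g 0) (𝓝[≠] 0) (𝓝 0) := by
        have : Tendsto (fun z : ℂ => z * g 0) (𝓝 0) (𝓝 (0 * g 0)) :=
          (continuous_id.mul continuous_const).tendsto 0
        rw [zero_mul] at this
        exact this.mono_left nhdsWithin_le_nhds
      have := hlim.sub h0
      rw [sub_zero] at this
      refine this.congr fun z => ?_
      simp only [sub_zero, div_inv_eq_mul, hg]; ring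
    · exact eventually_of_mem self_mem_nhdsWithin fun x hx hx' => (hx (by simpa using hx')).elim
  have hdo := Complex.differentiableOn_update_limUnder_of_isLittleO hS0
    (f := g) (fun z hz => (hgd z hz.2 hz.1.1.le hz.1.2.le).differentiableWithinAt) ho
  set G := Function.update g 0 (limUnder (𝓝[≠] 0) g) with hG
  have hGe : ∀ z, z ≠ 0 → G z = g z := fun z hz => by simp [hG, Function.update_of_ne hz]
  have hGd : ∀ z : ℂ, -n ≤ z.im → z.im ≤ e → DifferentiableAt ℂ G z := by
    intro z h1 h2
    by_cases hz : z = 0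
    · rw [hz]; exact (hdo 0 (mem_of_mem_nhds hS0)).differentiableAt hS0
    · refine (hgd z hz h1 h2).congr_of_eventuallyEq ?_
      filter_upwards [isOpen_ne.mem_nhds hz] with w hw using hGe w hw
  have hnorm : ∀ R : ℝ, 0 < R → ∀ y : ℝ, ‖((R:ℂ) + y * Complex.I)⁻¹‖ ≤ R⁻¹ ∧
      ‖(((-R:ℝ):ℂ) + y * Complex.I)⁻¹‖ ≤ R⁻¹ := by
    intro R hR y
    have n1 : R ≤ ‖(R:ℂ) + y * Complex.I‖ := by
      have := Complex.abs_re_le_norm ((R:ℂ) + y * Complex.I); simp at this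
      exact (le_abs_self R).trans this
    have n2 : R ≤ ‖((-R:ℝ):ℂ) + y * Complex.I‖ := by
      have := Complex.abs_re_le_norm (((-R:ℝ):ℂ) + y * Complex.I); simp at this
      simpa using (le_abs_self R).trans this
    rw [norm_inv, norm_inv]
    exact ⟨by gcongr, by gcongr⟩
  have hB' : Tendsto (fun R => B R + ‖q‖ * R⁻¹ ^ 3 + ‖r‖ * R⁻¹) atTop (𝓝 0) := by
    have h1 := (tendsto_inv_atTop_zero (𝕜 := ℝ))
    simpa using (hB.add ((h1.pow 3).const_mul ‖q‖)).add (h1.const_mul ‖r‖)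
  have hsh := shift_tendsto (y1 := -n) (y2 := e) (by linarith) G hGd _ hB' (by
    filter_upwards [hbd, eventually_gt_atTop 0] with R hR hR0 y hy1 hy2
    have aux : ∀ z : ℂ, z ≠ 0 → ‖f z‖ ≤ B R → ‖z⁻¹‖ ≤ R⁻¹ → ‖G z‖ ≤ B R + ‖q‖ * R⁻¹ ^ 3 + ‖r‖ * R⁻¹ := by
      intro z hz h1 h2
      rw [hGe z hz]
      refine (norm_sub_le _ _).trans (add_le_add ((norm_sub_le _ _).trans (add_le_add h1 ?_)) ?_)
      · rw [norm_mul, norm_pow]; gcongr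
      · rw [norm_mul]; gcongr
    refine ⟨aux _ ?_ (hR y hy1 hy2).1 (hnorm R hR0 y).1, aux _ ?_ (hR y hy1 hy2).2 (hnorm R hR0 y).2⟩
    · intro h; have := congrArg Complex.re h; simp at this; exact hR0.ne' this
    · intro h; have := congrArg Complex.re h; simp at this; exact hR0.ne' this)
  have hline : ∀ y : ℝ, y ≠ 0 → Integrable (fun t : ℝ => f (t + y * Complex.I)) → ∀ c : ℂ,
      Tendsto (fun R : ℝ => ∫ x : ℝ in (-R)..R, ((x:ℂ) + y * Complex.I)⁻¹) atTop (𝓝 c) →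
      Tendsto (fun R : ℝ => ∫ x : ℝ in (-R)..R, G (x + y * Complex.I)) atTop
        (𝓝 ((∫ t : ℝ, f (t + y * Complex.I)) - r * c)) := by
    intro y hy hi c hc
    have hne : ∀ x : ℝ, (x:ℂ) + y * Complex.I ≠ 0 := fun x h => by
      have := congrArg Complex.im h; simp at this; exact hy this
    have hcc : Continuous fun x : ℝ => ((x:ℂ) + y * Complex.I)⁻¹ :=
      (Continuous.inv₀ (by fun_prop) hne)
    have := ((tendsto_int_sym hi).sub ((tendsto_inv3_line hy).const_mul q)).sub (hc.const_mul r)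
    rw [mul_zero, sub_zero] at this
    refine this.congr fun R => ?_
    rw [← intervalIntegral.integral_const_mul, ← intervalIntegral.integral_const_mul,
      ← intervalIntegral.integral_sub hi.intervalIntegrable, ← intervalIntegral.integral_sub]
    · exact intervalIntegral.integral_congr fun x _ => (hGe _ (hne x)).symm
    · exact hi.intervalIntegrable.sub (Continuous.intervalIntegrable (by fun_prop) _ _)
    · exact Continuous.intervalIntegrable (by fun_prop) _ _
    · exact Continuous.intervalIntegrable (by fun_prop) _ _
  have l1 := hline e he.ne' hi1 _ (tendsto_inv_line he)
  have l2 := hline (-n) (by linarith) hi2 _ (tendsto_inv_line' (by linarith))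
  have := tendsto_nhds_unique hsh (l1.sub l2)
  linear_combination -this

end QD

namespace QD

open Filter Topology Set

structure Hyp (b ε : ℝ) : Prop where
  hb : 0 < b
  he : 0 < ε
  h1 : b * ε < Real.pi
  h2 : ε / b < Real.pi

lemma Hyp.mk' {b ε : ℝ} (hb : 0 < b) (hε0 : 0 < ε) (hε : ε < Real.pi * min b b⁻¹) : Hyp b ε := by
  refine ⟨hb, hε0, ?_, ?_⟩
  · have h : ε < Real.pi * b⁻¹ :=
      hε.trans_le (mul_le_mul_of_nonneg_left (min_le_right _ _) Real.pi_pos.le)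
    calc b * ε < b * (Real.pi * b⁻¹) := by gcongr
      _ = Real.pi := by field_simp
  · have h : ε < Real.pi * b :=
      hε.trans_le (mul_le_mul_of_nonneg_left (min_le_left _ _) Real.pi_pos.le)
    rwa [div_lt_iff₀ hb]

lemma sinh_re (w : ℂ) : (Complex.sinh w).re = Real.sinh w.re * Real.cos w.im := by
  conv_lhs => rw [← Complex.re_add_im w, Complex.sinh_add, Complex.sinh_mul_I, Complex.cosh_mul_I]
  rw [← Complex.ofReal_sinh, ← Complex.ofReal_cosh, ← Complex.ofReal_sin, ← Complex.ofReal_cos]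
  simp only [Complex.add_re, Complex.add_im, Complex.mul_re, Complex.mul_im, Complex.ofReal_re,
    Complex.ofReal_im, Complex.I_re, Complex.I_im]
  ring

lemma sinh_im (w : ℂ) : (Complex.sinh w).im = Real.cosh w.re * Real.sin w.im := by
  conv_lhs => rw [← Complex.re_add_im w, Complex.sinh_add, Complex.sinh_mul_I, Complex.cosh_mul_I]
  rw [← Complex.ofReal_sinh, ← Complex.ofReal_cosh, ← Complex.ofReal_sin, ← Complex.ofReal_cos]
  simp only [Complex.add_re, Complex.add_im, Complex.mul_re, Complex.mul_im, Complex.ofReal_re,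
    Complex.ofReal_im, Complex.I_re, Complex.I_im]
  ring

lemma norm_sinh_ge (w : ℂ) : Real.cosh w.re * |Real.sin w.im| ≤ ‖Complex.sinh w‖ := by
  have := Complex.abs_im_le_norm (Complex.sinh w)
  rwa [sinh_im, abs_mul, abs_of_pos (Real.cosh_pos _)] at this

lemma norm_sinh_ge' (w : ℂ) : |Real.sinh w.re| ≤ ‖Complex.sinh w‖ := by
  refine abs_le_of_sq_le_sq ?_ (norm_nonneg _)
  rw [Complex.sq_norm, Complex.normSq_apply, sinh_re, sinh_im]
  have h1 := Real.cosh_sq w.re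
  have h2 := Real.sin_sq_add_cos_sq w.im
  nlinarith [sq_nonneg (Real.sin w.im), sq_nonneg (Real.sinh w.re)]

lemma norm_sinh_far (w : ℂ) (hw : 1 ≤ |w.re|) : Real.exp |w.re| / 4 ≤ ‖Complex.sinh w‖ := by
  refine le_trans ?_ (norm_sinh_ge' w)
  have h0 : |Real.sinh w.re| = Real.sinh |w.re| := (Real.abs_sinh _)
  rw [h0, Real.sinh_eq]
  have h1 : Real.exp (-|w.re|) ≤ 1 := Real.exp_le_one_iff.2 (by linarith)
  have h2 : 2 ≤ Real.exp |w.re| := by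
    have := Real.add_one_le_exp |w.re|; linarith
  linarith

lemma sinh_ne_zero {w : ℂ} (hw : w ≠ 0) (h : |w.im| < Real.pi) : Complex.sinh w ≠ 0 := by
  intro h0
  have h1 := sinh_re w
  have h2 := sinh_im w
  rw [h0] at h1 h2
  simp only [Complex.zero_re, Complex.zero_im] at h1 h2
  have h3 : Real.sin w.im = 0 := by
    rcases mul_eq_zero.1 h2.symm with h | h
    · exact absurd h (Real.cosh_pos _).ne'
    · exact h
  have h4 : w.im = 0 := (Real.sin_eq_zero_iff_of_lt_of_lt (abs_lt.1 h).1 (abs_lt.1 h).2).1 h3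
  rw [h4, Real.cos_zero, mul_one] at h1
  exact hw (Complex.ext (by simpa using h1.symm) (by simpa using h4))

noncomputable def jI (b ε : ℝ) (z : ℂ) (t : ℝ) : ℂ :=
  Complex.exp (-(2 * Complex.I * ((t : ℂ) + Complex.I * (ε : ℂ)) * z)) /
        (4 * ((t : ℂ) + Complex.I * (ε : ℂ)) *
          Complex.sinh ((b : ℂ) * ((t : ℂ) + Complex.I * (ε : ℂ))) *
          Complex.sinh (((t : ℂ) + Complex.I * (ε : ℂ)) / (b : ℂ)))

noncomputable def qJ (b ε : ℝ) (z : ℂ) : ℂ := ∫ t : ℝ, jI b ε z t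

noncomputable def qE (b ε : ℝ) (z : ℂ) : ℂ :=
  Complex.I * ((Real.pi : ℝ) : ℂ) / 2 * z ^ 2 +
    Complex.I * ((Real.pi : ℝ) : ℂ) / 24 * ((b : ℂ) ^ 2 + ((b : ℂ))⁻¹ ^ 2) - qJ b ε z

lemma wb_eq (b ε : ℝ) (z : ℂ) : wb b ε z = Complex.exp (qE b ε z) := rfl

lemma norm_num_exp (ε : ℝ) (z : ℂ) (t : ℝ) :
    ‖Complex.exp (-(2 * Complex.I * ((t : ℂ) + Complex.I * (ε : ℂ)) * z))‖ =
      Real.exp (2 * t * z.im + 2 * ε * z.re) := by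
  rw [Complex.norm_exp]; congr 1; simp

variable {b ε : ℝ}

lemma T_ne (h : Hyp b ε) (t : ℝ) : (t : ℂ) + Complex.I * (ε : ℂ) ≠ 0 := fun h' => by
  have := congrArg Complex.im h'; simp at this; exact h.he.ne' this

lemma sb1 (h : Hyp b ε) (t : ℝ) : Real.sin (b * ε) * (Real.exp (b * |t|) / 2) ≤
    ‖Complex.sinh ((b : ℂ) * ((t : ℂ) + Complex.I * (ε : ℂ)))‖ := by
  have hs : 0 < Real.sin (b * ε) := Real.sin_pos_of_pos_of_lt_pi (mul_pos h.hb h.he) h.h1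
  refine le_trans ?_ (norm_sinh_ge _)
  have e1 : ((b : ℂ) * ((t : ℂ) + Complex.I * (ε : ℂ))).re = b * t := by simp
  have e2 : ((b : ℂ) * ((t : ℂ) + Complex.I * (ε : ℂ))).im = b * ε := by simp
  rw [e1, e2, abs_of_pos hs, mul_comm]
  gcongr
  rw [← Real.cosh_abs, abs_mul, abs_of_pos h.hb, Real.cosh_eq]
  have := Real.exp_pos (-(b * |t|))
  linarith

lemma sb2 (h : Hyp b ε) (t : ℝ) : Real.sin (ε / b) * (Real.exp (b⁻¹ * |t|) / 2) ≤
    ‖Complex.sinh (((t : ℂ) + Complex.I * (ε : ℂ)) / (b : ℂ))‖ := by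
  have h' : Hyp b⁻¹ ε := ⟨inv_pos.2 h.hb, h.he, by rw [mul_comm, ← div_eq_mul_inv]; exact h.h2,
    by rw [div_inv_eq_mul, mul_comm]; exact h.h1⟩
  have := sb1 h' t
  rw [mul_comm b⁻¹ ε, ← div_eq_mul_inv] at this
  refine this.trans (le_of_eq ?_)
  push_cast; rw [div_eq_mul_inv, mul_comm]

lemma jI_bound (h : Hyp b ε) : ∃ K : ℝ, 0 < K ∧ ∀ (z : ℂ) (t : ℝ), ‖jI b ε z t‖ ≤
    K * Real.exp (2 * ε * z.re) * Real.exp (-((b + b⁻¹ - 2 * |z.im|) * |t|)) := by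
  have hs1 : 0 < Real.sin (b * ε) := Real.sin_pos_of_pos_of_lt_pi (mul_pos h.hb h.he) h.h1
  have hs2 : 0 < Real.sin (ε / b) := Real.sin_pos_of_pos_of_lt_pi (div_pos h.he h.hb) h.h2
  have he := h.he
  refine ⟨(ε * Real.sin (b * ε) * Real.sin (ε / b))⁻¹, by positivity, fun z t => ?_⟩
  have hT : ε ≤ ‖(t : ℂ) + Complex.I * (ε : ℂ)‖ := by
    have := Complex.abs_im_le_norm ((t : ℂ) + Complex.I * (ε : ℂ))
    simp at this
    exact (le_abs_self _).trans this
  have hden : 4 * ε * (Real.sin (b * ε) * (Real.exp (b * |t|) / 2)) *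
      (Real.sin (ε / b) * (Real.exp (b⁻¹ * |t|) / 2)) ≤
      ‖4 * ((t : ℂ) + Complex.I * (ε : ℂ)) *
          Complex.sinh ((b : ℂ) * ((t : ℂ) + Complex.I * (ε : ℂ))) *
          Complex.sinh (((t : ℂ) + Complex.I * (ε : ℂ)) / (b : ℂ))‖ := by
    rw [norm_mul, norm_mul, norm_mul, Complex.norm_ofNat]
    gcongr
    · exact sb1 h t
    · exact sb2 h t
  rw [jI, norm_div, norm_num_exp]
  refine (div_le_div_of_nonneg_left (Real.exp_pos _).le (by positivity) hden).trans ?_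
  have e3 : 4 * ε * (Real.sin (b * ε) * (Real.exp (b * |t|) / 2)) *
      (Real.sin (ε / b) * (Real.exp (b⁻¹ * |t|) / 2)) =
      (ε * Real.sin (b * ε) * Real.sin (ε / b)) * Real.exp ((b + b⁻¹) * |t|) := by
    rw [add_mul, Real.exp_add]; ring
  rw [e3, div_le_iff₀ (by positivity)]
  have e4 : (ε * Real.sin (b * ε) * Real.sin (ε / b))⁻¹ * Real.exp (2 * ε * z.re) *
      Real.exp (-((b + b⁻¹ - 2 * |z.im|) * |t|)) *
      (ε * Real.sin (b * ε) * Real.sin (ε / b) * Real.exp ((b + b⁻¹) * |t|)) =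
      Real.exp (2 * |z.im| * |t| + 2 * ε * z.re) := by
    have hs1' := hs1.ne'
    have hs2' := hs2.ne'
    generalize Real.sin (b * ε) = s1 at *
    generalize Real.sin (ε / b) = s2 at *
    rw [show (2 * |z.im| * |t| + 2 * ε * z.re) = 2 * ε * z.re +
      (-((b + b⁻¹ - 2 * |z.im|) * |t|) + (b + b⁻¹) * |t|) by ring, Real.exp_add, Real.exp_add]
    field_simp
  rw [e4]
  refine Real.exp_le_exp.2 ?_
  have : t * z.im ≤ |z.im| * |t| := by rw [mul_comm |z.im|, ← abs_mul]; exact le_abs_self _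
  linarith

lemma den_ne (h : Hyp b ε) (t : ℝ) : (4 * ((t : ℂ) + Complex.I * (ε : ℂ)) *
          Complex.sinh ((b : ℂ) * ((t : ℂ) + Complex.I * (ε : ℂ))) *
          Complex.sinh (((t : ℂ) + Complex.I * (ε : ℂ)) / (b : ℂ))) ≠ 0 := by
  have hs1 : 0 < Real.sin (b * ε) := Real.sin_pos_of_pos_of_lt_pi (mul_pos h.hb h.he) h.h1
  have hs2 : 0 < Real.sin (ε / b) := Real.sin_pos_of_pos_of_lt_pi (div_pos h.he h.hb) h.h2
  have := T_ne h t
  refine mul_ne_zero (mul_ne_zero (mul_ne_zero (by norm_num) this) ?_) ?_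
  · exact norm_pos_iff.1 (lt_of_lt_of_le (by positivity) (sb1 h t))
  · exact norm_pos_iff.1 (lt_of_lt_of_le (by positivity) (sb2 h t))

lemma jI_cont (h : Hyp b ε) (z : ℂ) : Continuous (jI b ε z) := by
  unfold jI
  refine Continuous.div (by fun_prop) ?_ (den_ne h)
  have : (b:ℂ) ≠ 0 := by exact_mod_cast h.hb.ne'
  simp only [div_eq_mul_inv]
  fun_prop

lemma jI_int (h : Hyp b ε) {z : ℂ} (hz : |z.im| < (b + b⁻¹) / 2) : Integrable (jI b ε z) := by
  obtain ⟨K, hK, hb⟩ := jI_bound h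
  exact ((integrable_exp_neg_abs (c := b + b⁻¹ - 2 * |z.im|) (by linarith)).const_mul _).mono'
    (jI_cont h z).aestronglyMeasurable (Eventually.of_forall fun t => hb z t)

lemma qJ_bound (h : Hyp b ε) {m : ℝ} (hm : m < (b + b⁻¹) / 2) : ∃ M : ℝ, 0 ≤ M ∧
    ∀ z : ℂ, |z.im| ≤ m → ‖qJ b ε z‖ ≤ M * Real.exp (2 * ε * z.re) := by
  obtain ⟨K, hK, hb⟩ := jI_bound h
  have hi := integrable_exp_neg_abs (c := b + b⁻¹ - 2 * m) (by linarith)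
  refine ⟨K * ∫ t, Real.exp (-((b + b⁻¹ - 2 * m) * |t|)), mul_nonneg hK.le
    (integral_nonneg fun t => (Real.exp_pos _).le), fun z hz => ?_⟩
  have := norm_integral_le_of_norm_le (hi.const_mul (K * Real.exp (2 * ε * z.re)))
    (f := jI b ε z) (Eventually.of_forall fun t => (hb z t).trans (by gcongr))
  rw [integral_const_mul] at this
  refine this.trans (le_of_eq (by ring))

lemma isOpen_strip (m : ℝ) : IsOpen {z : ℂ | |z.im| < m} :=
  isOpen_lt (continuous_abs.comp Complex.continuous_im) continuous_const

lemma qJ_diff (h : Hyp b ε) {z : ℂ} (hz : |z.im| < (b + b⁻¹) / 2) :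
    DifferentiableAt ℂ (qJ b ε) z := by
  obtain ⟨K, hK, hb⟩ := jI_bound h
  set d := ((b + b⁻¹) / 2 - |z.im|) / 2 with hd
  have hd0 : 0 < d := by rw [hd]; linarith
  refine (hasDerivAt_param (isOpen_strip ((b + b⁻¹) / 2)) (jI b ε) (fun t => ?_)
    (fun z _ => (jI_cont h z).aestronglyMeasurable) hz ⟨d, hd0,
      fun t => K * Real.exp (2 * ε * (z.re + d)) * Real.exp (-((2 * d) * |t|)),
      (integrable_exp_neg_abs (by linarith)).const_mul _, fun w _ hw t => ?_⟩).differentiableAt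
  · unfold jI; fun_prop
  · refine (hb w t).trans ?_
    have h1 := (Complex.abs_re_le_norm (w - z)).trans hw
    have h2 := (Complex.abs_im_le_norm (w - z)).trans hw
    rw [Complex.sub_re] at h1
    rw [Complex.sub_im] at h2
    have h3 : |w.im| ≤ |z.im| + d := by
      have := abs_sub_abs_le_abs_sub w.im z.im; linarith
    have h4 := (abs_le.1 h1).2
    have := h.he
    refine mul_le_mul (mul_le_mul_of_nonneg_left (Real.exp_le_exp.2 ?_) hK.le)
      (Real.exp_le_exp.2 ?_) (Real.exp_pos _).le (by positivity)
    · gcongr; linarith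
    · rw [neg_le_neg_iff]; gcongr; linarith

lemma qE_diff (h : Hyp b ε) {z : ℂ} (hz : |z.im| < (b + b⁻¹) / 2) :
    DifferentiableAt ℂ (qE b ε) z := by
  have := qJ_diff h hz
  unfold qE
  fun_prop

/-! expansions at zero -/

lemma exp_O (n : ℕ) (hn : 0 < n) : (fun x : ℂ => Complex.exp x - ∑ m ∈ Finset.range n, x ^ m / m.factorial)
    =O[𝓝 0] fun x => x ^ n := by
  refine Asymptotics.IsBigO.of_bound ((n.succ : ℝ) * ((n.factorial : ℝ) * n)⁻¹) ?_
  filter_upwards [Metric.closedBall_mem_nhds (0:ℂ) one_pos] with x hx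
  have := Complex.exp_bound (x := x) (by simpa using hx) hn
  rw [norm_pow, mul_comm]
  exact_mod_cast this

lemma lim_of_O {f : ℂ → ℂ} {n : ℕ} (hf : f =O[𝓝 0] fun x => x ^ (n+1)) (c : ℂ) :
    Tendsto (fun T => f (c * T) / T ^ n) (𝓝[≠] 0) (𝓝 0) := by
  have h1 : Tendsto (fun T : ℂ => c * T) (𝓝 0) (𝓝 0) := by
    have : Tendsto (fun T : ℂ => c * T) (𝓝 0) (𝓝 (c * 0)) := tendsto_id.const_mul c
    rwa [mul_zero] at this
  have h2 := hf.comp_tendsto h1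
  have h3 : (fun T => f (c * T)) =O[𝓝 0] fun T : ℂ => T ^ (n+1) := by
    refine h2.trans ?_
    refine Asymptotics.IsBigO.of_bound (‖c‖ ^ (n+1)) (Eventually.of_forall fun T => ?_)
    simp [mul_pow]
  have h4 : (fun T => f (c * T)) =o[𝓝 0] fun T : ℂ => T ^ n := by
    refine h3.trans_isLittleO ?_
    simpa using (Asymptotics.isLittleO_pow_pow (𝕜 := ℂ) (Nat.lt_succ_self n))
  exact (h4.mono nhdsWithin_le_nhds).tendsto_div_nhds_zero

lemma neg_comp_O {f : ℂ → ℂ} {n : ℕ} (hf : f =O[𝓝 0] fun x => x ^ n) :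
    (fun x => f (-x)) =O[𝓝 0] fun x => x ^ n := by
  have h1 : Tendsto (fun T : ℂ => -T) (𝓝 0) (𝓝 0) := by
    simpa using (continuous_neg (G := ℂ)).tendsto 0
  have := hf.comp_tendsto h1
  refine this.trans (Asymptotics.IsBigO.of_bound 1 (Eventually.of_forall fun T => ?_))
  simp

lemma sinh_O : (fun x : ℂ => Complex.sinh x - x - x ^ 3 / 6) =O[𝓝 0] fun x => x ^ (3+1) := by
  have h := exp_O 4 (by norm_num)
  have h2 := ((h.sub (neg_comp_O h)).const_mul_left (1/2))
  refine h2.congr_left fun x => ?_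
  rw [Complex.sinh]
  simp [Finset.sum_range_succ, Nat.factorial]
  ring

lemma cosh_O : (fun x : ℂ => Complex.cosh x - 1 - x ^ 2 / 2) =O[𝓝 0] fun x => x ^ (2+1) := by
  have h := exp_O 3 (by norm_num)
  have h2 := ((h.add (neg_comp_O h)).const_mul_left (1/2))
  refine h2.congr_left fun x => ?_
  rw [Complex.cosh]
  simp [Finset.sum_range_succ, Nat.factorial]
  ring

lemma lim_sinh {c : ℂ} (hc : c ≠ 0) :
    Tendsto (fun T : ℂ => (Complex.sinh (c * T) / (c * T) - 1) / T ^ 2) (𝓝[≠] 0) (𝓝 (c ^ 2 / 6)) := by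
  have h := ((lim_of_O sinh_O c).div_const c).add_const (c ^ 2 / 6)
  simp only [zero_div, zero_add] at h
  refine h.congr' ?_
  filter_upwards [self_mem_nhdsWithin] with T hT
  have : T ≠ 0 := hT
  field_simp
  ring

lemma lim_cosh (c : ℂ) :
    Tendsto (fun T : ℂ => (Complex.cosh (c * T) - 1) / T ^ 2) (𝓝[≠] 0) (𝓝 (c ^ 2 / 2)) := by
  have h := ((lim_of_O cosh_O c)).add_const (c ^ 2 / 2)
  simp only [zero_add] at h
  refine h.congr' ?_
  filter_upwards [self_mem_nhdsWithin] with T hT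
  have : T ≠ 0 := hT
  field_simp
  ring

lemma lim_res {b : ℂ} (hb : b ≠ 0) (c : ℂ) :
    Tendsto (fun T : ℂ => T * (2 * Complex.cosh (c * T) /
      (4 * T * Complex.sinh (b * T) * Complex.sinh (T / b)) - (1/2) * T⁻¹ ^ 3 -
      (c ^ 2 / 4 - (b ^ 2 + b⁻¹ ^ 2) / 12) * T⁻¹)) (𝓝[≠] 0) (𝓝 0) := by
  have hA := lim_sinh hb
  have hB := lim_sinh (inv_ne_zero hb)
  have hC := lim_cosh c
  have hT : Tendsto (fun T : ℂ => T ^ 2) (𝓝[≠] 0) (𝓝 0) := by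
    have : Tendsto (fun T : ℂ => T ^ 2) (𝓝 0) (𝓝 (0 ^ 2)) := (continuous_pow 2).tendsto 0
    rw [zero_pow (by norm_num)] at this
    exact this.mono_left nhdsWithin_le_nhds
  have hden := (((hT.mul hA).const_add 1).mul ((hT.mul hB).const_add 1)).const_mul 2
  have hnum := ((hC.sub hA).sub hB).sub ((hT.mul hA).mul hB)
  have hne : (2 * ((1 + 0 * (b ^ 2 / 6)) * (1 + 0 * (b⁻¹ ^ 2 / 6))) : ℂ) ≠ 0 := by norm_num
  have h := (hnum.div hden hne).sub_const (c ^ 2 / 4 - (b ^ 2 + b⁻¹ ^ 2) / 12)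
  have e0 : ((c ^ 2 / 2 - b ^ 2 / 6 - b⁻¹ ^ 2 / 6 - 0 * (b ^ 2 / 6) * (b⁻¹ ^ 2 / 6)) /
      (2 * ((1 + 0 * (b ^ 2 / 6)) * (1 + 0 * (b⁻¹ ^ 2 / 6)))) -
      (c ^ 2 / 4 - (b ^ 2 + b⁻¹ ^ 2) / 12)) = (0:ℂ) := by ring
  rw [e0] at h
  refine h.congr' ?_
  have hne' := hden.eventually_ne hne
  filter_upwards [self_mem_nhdsWithin, hne'] with T hT0 hd
  have hT0 : T ≠ 0 := hT0
  have s1 : 1 + T ^ 2 * ((Complex.sinh (b * T) / (b * T) - 1) / T ^ 2) =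
      Complex.sinh (b * T) / (b * T) := by field_simp; ring
  have s2 : 1 + T ^ 2 * ((Complex.sinh (b⁻¹ * T) / (b⁻¹ * T) - 1) / T ^ 2) =
      Complex.sinh (b⁻¹ * T) / (b⁻¹ * T) := by field_simp; ring
  rw [s1, s2] at hd
  simp only [Pi.div_apply]
  rw [s1, s2]
  have hs1 : Complex.sinh (b * T) ≠ 0 := by rintro h; simp [h] at hd
  have hs2 : Complex.sinh (b⁻¹ * T) ≠ 0 := by rintro h; simp [h] at hd
  rw [show T / b = b⁻¹ * T by rw [div_eq_mul_inv, mul_comm]]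
  generalize Complex.sinh (b * T) = S1 at *
  generalize Complex.sinh (b⁻¹ * T) = S2 at *
  generalize Complex.cosh (c * T) = C at *
  field_simp
  ring

end QD

namespace QD

open Filter Topology Set
variable {b ε : ℝ}

lemma norm_cosh_le (w : ℂ) : ‖Complex.cosh w‖ ≤ Real.exp |w.re| := by
  rw [Complex.cosh, norm_div, Complex.norm_ofNat, div_le_iff₀ (by norm_num)]
  refine (norm_add_le _ _).trans ?_
  rw [Complex.norm_exp, Complex.norm_exp, Complex.neg_re]
  have h1 := Real.exp_le_exp.2 (le_abs_self w.re)
  have h2 := Real.exp_le_exp.2 (neg_le_abs w.re)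
  linarith

lemma den_diff_ne (h : Hyp b ε) {T : ℂ} (hT : T ≠ 0) (h1 : |T.im| ≤ ε) :
    4 * T * Complex.sinh (b * T) * Complex.sinh (T / b) ≠ 0 := by
  have hb := h.hb
  have hb' : (b:ℂ) ≠ 0 := by exact_mod_cast hb.ne'
  refine mul_ne_zero (mul_ne_zero (mul_ne_zero (by norm_num) hT) ?_) ?_
  · refine sinh_ne_zero (mul_ne_zero hb' hT) ?_
    have : ((b:ℂ) * T).im = b * T.im := by simp
    rw [this, abs_mul, abs_of_pos hb]
    exact (mul_le_mul_of_nonneg_left h1 hb.le).trans_lt h.h1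
  · refine sinh_ne_zero (div_ne_zero hT hb') ?_
    have : (T / (b:ℂ)).im = T.im / b := by simp
    rw [this, abs_div, abs_of_pos hb]
    exact (div_le_div_of_nonneg_right h1 hb.le).trans_lt h.h2

lemma two_arg_re (z T : ℂ) : |(2 * Complex.I * z * T).re| ≤ 2 * |z.im| * |T.re| + 2 * |z.re| * |T.im| := by
  have : (2 * Complex.I * z * T).re = -(2 * (z.im * T.re)) - 2 * (z.re * T.im) := by
    simp [Complex.mul_re, Complex.mul_im]; ring
  rw [this]
  refine (abs_sub _ _).trans ?_
  rw [abs_neg, abs_mul, abs_mul, abs_mul, abs_mul]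
  simp; linarith

lemma qJ_add_neg (h : Hyp b ε) {z : ℂ} (hz : |z.im| < (b + b⁻¹) / 2) :
    qJ b ε z + qJ b ε (-z) = Complex.I * Real.pi * z ^ 2 +
      Complex.I * Real.pi / 12 * ((b:ℂ) ^ 2 + ((b:ℂ))⁻¹ ^ 2) := by
  have hb := h.hb
  have hb' : (b:ℂ) ≠ 0 := by exact_mod_cast hb.ne'
  set f : ℂ → ℂ := fun T => 2 * Complex.cosh (2 * Complex.I * z * T) /
      (4 * T * Complex.sinh (b * T) * Complex.sinh (T / b)) with hf
  have hz' : |(-z).im| < (b + b⁻¹) / 2 := by simpa using hz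
  have hpt : ∀ t : ℝ, jI b ε z t + jI b ε (-z) t = f (t + Complex.I * ε) := by
    intro t
    simp only [hf, jI]
    rw [← add_div, Complex.cosh]
    congr 1
    rw [mul_div_cancel₀ _ (two_ne_zero), add_comm]
    congr 2 <;> ring
  have hodd : ∀ T, f (-T) = -f T := by
    intro T
    simp only [hf]
    rw [show (b:ℂ) * -T = -(b * T) by ring, show 2 * Complex.I * z * -T = -(2 * Complex.I * z * T) by ring,
      neg_div, Complex.cosh_neg, Complex.sinh_neg, Complex.sinh_neg, ← div_neg]
    congr 1; ring
  have hsum : qJ b ε z + qJ b ε (-z) = ∫ t : ℝ, f (t + ε * Complex.I) := by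
    rw [qJ, qJ, ← integral_add (jI_int h hz) (jI_int h hz')]
    refine integral_congr_ae (Eventually.of_forall fun t => ?_)
    simp only [hpt, mul_comm]
  have hi1 : Integrable fun t : ℝ => f (t + ε * Complex.I) := by
    refine ((jI_int h hz).add (jI_int h hz')).congr (Eventually.of_forall fun t => ?_)
    simp only [Pi.add_apply, hpt, mul_comm]
  have hneg : ∀ t : ℝ, f (t + (-ε : ℝ) * Complex.I) = - f (((-t:ℝ):ℂ) + ε * Complex.I) := by
    intro t
    rw [← hodd]; congr 1; push_cast; ring
  have hi2 : Integrable fun t : ℝ => f (t + (-ε : ℝ) * Complex.I) := by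
    simp only [hneg]
    exact (hi1.comp_neg).neg
  have hint2 : ∫ t : ℝ, f (t + (-ε : ℝ) * Complex.I) = - ∫ t : ℝ, f (t + ε * Complex.I) := by
    simp only [hneg]
    rw [integral_neg, integral_neg_eq_self (fun t : ℝ => f (t + ε * Complex.I))]
  have hfar : ∀ R : ℝ, 1 ≤ R → 1 ≤ b * R → 1 ≤ b⁻¹ * R → ∀ T : ℂ, |T.re| = R → |T.im| ≤ ε →
      ‖f T‖ ≤ 8 * Real.exp (2 * |z.re| * ε) * Real.exp (-((b + b⁻¹ - 2 * |z.im|) * R)) := by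
    intro R hR hR1 hR2 T hT hT'
    have n1 : Real.exp (b * R) / 4 ≤ ‖Complex.sinh (b * T)‖ := by
      have e : |((b:ℂ) * T).re| = b * R := by rw [← hT]; simp [abs_mul, abs_of_pos hb]
      have := norm_sinh_far (b * T) (by rw [e]; exact hR1)
      rwa [e] at this
    have n2 : Real.exp (b⁻¹ * R) / 4 ≤ ‖Complex.sinh (T / b)‖ := by
      have e : |(T / (b:ℂ)).re| = b⁻¹ * R := by
        rw [← hT]; simp [abs_div, abs_of_pos hb]; field_simp
      have := norm_sinh_far (T / b) (by rw [e]; exact hR2)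
      rwa [e] at this
    have n3 : 1 ≤ ‖T‖ := by
      have := Complex.abs_re_le_norm T; linarith
    have n4 : ‖2 * Complex.cosh (2 * Complex.I * z * T)‖ ≤
        2 * Real.exp (2 * |z.im| * R + 2 * |z.re| * ε) := by
      rw [norm_mul, Complex.norm_ofNat]
      refine mul_le_mul_of_nonneg_left ((norm_cosh_le _).trans (Real.exp_le_exp.2 ?_)) (by norm_num)
      refine (two_arg_re z T).trans ?_
      rw [hT]
      gcongr
    have hden : 4 * 1 * (Real.exp (b * R) / 4) * (Real.exp (b⁻¹ * R) / 4) ≤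
      ‖4 * T * Complex.sinh (b * T) * Complex.sinh (T / b)‖ := by
      rw [norm_mul, norm_mul, norm_mul, Complex.norm_ofNat]
      gcongr
    simp only [hf]
    rw [norm_div]
    refine (div_le_div₀ (by positivity) n4 (by positivity) hden).trans (le_of_eq ?_)
    rw [div_eq_iff (by positivity)]
    rw [show -((b + b⁻¹ - 2 * |z.im|) * R) = 2 * |z.im| * R - b * R - b⁻¹ * R by ring,
      Real.exp_sub, Real.exp_sub, Real.exp_add]
    field_simp
    norm_num
  have key := contour_residue h.he h.he f (1/2)
    ((2 * Complex.I * z) ^ 2 / 4 - ((b:ℂ) ^ 2 + ((b:ℂ))⁻¹ ^ 2) / 12)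
    (fun T hT h1 h2 => by
      simp only [hf]
      refine DifferentiableAt.div (by fun_prop) ?_ (den_diff_ne h hT (abs_le.2 ⟨h1, h2⟩))
      simp only [div_eq_mul_inv]; fun_prop)
    (lim_res hb' _)
    (fun R => 8 * Real.exp (2 * |z.re| * ε) * Real.exp (-((b + b⁻¹ - 2 * |z.im|) * R)))
    (by
      have : Tendsto (fun R : ℝ => Real.exp (-((b + b⁻¹ - 2 * |z.im|) * R))) atTop (𝓝 0) :=
        Real.tendsto_exp_neg_atTop_nhds_zero.comp
          (tendsto_id.const_mul_atTop (by linarith : 0 < b + b⁻¹ - 2 * |z.im|))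
      simpa using this.const_mul (8 * Real.exp (2 * |z.re| * ε)))
    (by
      filter_upwards [eventually_ge_atTop 1,
        (tendsto_id.const_mul_atTop hb).eventually (eventually_ge_atTop 1),
        (tendsto_id.const_mul_atTop (inv_pos.2 hb)).eventually (eventually_ge_atTop 1)]
        with R h1 h2 h3 y hy1 hy2
      have hy : |y| ≤ ε := abs_le.2 ⟨hy1, hy2⟩
      have hR : |R| = R := abs_of_pos (by linarith)
      exact ⟨hfar R h1 h2 h3 _ (by simpa using hR) (by simpa using hy),
        hfar R h1 h2 h3 _ (by simpa using hR) (by simpa using hy)⟩)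
    hi1 hi2
  rw [hint2, ← hsum] at key
  linear_combination (1/2) * key + (-Real.pi * Complex.I * z^2) * Complex.I_sq

lemma qE_neg (h : Hyp b ε) {z : ℂ} (hz : |z.im| < (b + b⁻¹) / 2) :
    qE b ε (-z) = - qE b ε z := by
  have := qJ_add_neg h hz
  unfold qE
  linear_combination -this

lemma Dfun_eq (h : Hyp b ε) {α z : ℂ} (hz : |z.im| + |α.im| < (b + b⁻¹) / 2) :
    Dfun b ε α z = Complex.exp (qE b ε (z + α) - qE b ε (z - α)) := by
  have h1 : |(z + α).im| < (b + b⁻¹) / 2 := by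
    rw [Complex.add_im]; exact (abs_add_le _ _).trans_lt hz
  have h2 : |(z - α).im| < (b + b⁻¹) / 2 := by
    rw [Complex.sub_im]; exact (abs_sub _ _).trans_lt hz
  have h1' : |(-(z + α)).im| < (b + b⁻¹) / 2 := by rwa [Complex.neg_im, abs_neg]
  have h2' : |(-(z - α)).im| < (b + b⁻¹) / 2 := by rwa [Complex.neg_im, abs_neg]
  unfold Dfun
  congr 1
  have e1 := qE_neg h h1
  have e2 := qE_neg h h2
  have e3 : qE b ε (z + α) - qE b ε (z - α) = (1/2) * (qJ b ε (-(z+α)) - qJ b ε (z+α) -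
      qJ b ε (-(z-α)) + qJ b ε (z-α)) := by
    have : qE b ε (z + α) - qE b ε (z - α) = (1/2) * (qE b ε (z + α) - qE b ε (-(z + α)) -
      qE b ε (z - α) + qE b ε (-(z - α))) := by rw [e1, e2]; ring
    rw [this]; unfold qE; ring
  rw [e3]
  simp only [qJ]
  have hs1 : Integrable (fun a => jI b ε (-(z+α)) a - jI b ε (z+α) a) := (jI_int h h1').sub (jI_int h h1)
  have hs2 : Integrable (fun a => jI b ε (-(z+α)) a - jI b ε (z+α) a - jI b ε (-(z-α)) a) :=
    hs1.sub (jI_int h h2')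
  rw [← integral_sub (jI_int h h1') (jI_int h h1), ← integral_sub hs1 (jI_int h h2'),
    ← integral_add hs2 (jI_int h h2),
    ← integral_const_mul, ← integral_const_mul]
  refine integral_congr_ae (Eventually.of_forall fun t => ?_)
  simp only [Pi.sub_apply, jI]
  have hd := den_ne h t
  generalize (t:ℂ) + Complex.I * ε = T at *
  have a1 : Complex.exp (-(2 * Complex.I * T * -(z + α))) =
    Complex.exp (2 * T * z * Complex.I) * Complex.exp (2 * α * T * Complex.I) := by
    rw [← Complex.exp_add]; congr 1; ring
  have a2 : Complex.exp (-(2 * Complex.I * T * (z + α))) =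
    Complex.exp (-(2 * T * z) * Complex.I) * Complex.exp (-(2 * α * T) * Complex.I) := by
    rw [← Complex.exp_add]; congr 1; ring
  have a3 : Complex.exp (-(2 * Complex.I * T * -(z - α))) =
    Complex.exp (2 * T * z * Complex.I) * Complex.exp (-(2 * α * T) * Complex.I) := by
    rw [← Complex.exp_add]; congr 1; ring
  have a4 : Complex.exp (-(2 * Complex.I * T * (z - α))) =
    Complex.exp (-(2 * T * z) * Complex.I) * Complex.exp (2 * α * T * Complex.I) := by
    rw [← Complex.exp_add]; congr 1; ring
  rw [a1, a2, a3, a4, Complex.cos, Complex.sin]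
  generalize Complex.exp (2 * T * z * Complex.I) = p
  generalize Complex.exp (2 * α * T * Complex.I) = q
  generalize Complex.exp (-(2 * T * z) * Complex.I) = p'
  generalize Complex.exp (-(2 * α * T) * Complex.I) = q'
  have hd1 := left_ne_zero_of_mul hd
  have hd2 := right_ne_zero_of_mul hd
  have hd3 := left_ne_zero_of_mul hd1
  have hd4 := right_ne_zero_of_mul hd1
  have hd5 := right_ne_zero_of_mul hd3
  generalize Complex.sinh (b * T) = S1 at *
  generalize Complex.sinh (T / b) = S2 at *
  field_simp
  linear_combination 4 * (p + p') * (q' - q) * Complex.I_sq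

/-! functional equation -/

noncomputable def nI (b ε : ℝ) (z : ℂ) (t : ℝ) : ℂ :=
  Complex.exp (-(2 * Complex.I * ((t : ℂ) + Complex.I * (ε : ℂ)) * z)) /
          Complex.sinh (((t : ℂ) + Complex.I * (ε : ℂ)) / (b : ℂ))

lemma sinh2_ne (h : Hyp b ε) (t : ℝ) : Complex.sinh (((t : ℂ) + Complex.I * (ε : ℂ)) / (b : ℂ)) ≠ 0 :=
  right_ne_zero_of_mul (den_ne h t)

lemma nI_cont (h : Hyp b ε) (z : ℂ) : Continuous (nI b ε z) := by
  unfold nI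
  refine Continuous.div (by fun_prop) ?_ (sinh2_ne h)
  simp only [div_eq_mul_inv]
  fun_prop

lemma nI_bound (h : Hyp b ε) : ∃ K : ℝ, 0 < K ∧ ∀ (z : ℂ) (t : ℝ), ‖nI b ε z t‖ ≤
    K * Real.exp (2 * ε * z.re) * Real.exp (-((b⁻¹ - 2 * |z.im|) * |t|)) := by
  have hs2 : 0 < Real.sin (ε / b) := Real.sin_pos_of_pos_of_lt_pi (div_pos h.he h.hb) h.h2
  refine ⟨2 * (Real.sin (ε / b))⁻¹, by positivity, fun z t => ?_⟩
  rw [nI, norm_div, norm_num_exp]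
  refine (div_le_div_of_nonneg_left (Real.exp_pos _).le (by positivity) (sb2 h t)).trans ?_
  rw [div_le_iff₀ (by positivity)]
  have e4 : 2 * (Real.sin (ε / b))⁻¹ * Real.exp (2 * ε * z.re) *
      Real.exp (-((b⁻¹ - 2 * |z.im|) * |t|)) *
      (Real.sin (ε / b) * (Real.exp (b⁻¹ * |t|) / 2)) =
      Real.exp (2 * |z.im| * |t| + 2 * ε * z.re) := by
    have hs2' := hs2.ne'
    generalize Real.sin (ε / b) = s2 at *
    rw [show (2 * |z.im| * |t| + 2 * ε * z.re) = 2 * ε * z.re +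
      (-((b⁻¹ - 2 * |z.im|) * |t|) + (b⁻¹) * |t|) by ring, Real.exp_add, Real.exp_add]
    field_simp
  rw [e4]
  refine Real.exp_le_exp.2 ?_
  have : t * z.im ≤ |z.im| * |t| := by rw [mul_comm |z.im|, ← abs_mul]; exact le_abs_self _
  linarith

lemma nI_int (h : Hyp b ε) {z : ℂ} (hz : |z.im| < b⁻¹ / 2) : Integrable (nI b ε z) := by
  obtain ⟨K, hK, hb⟩ := nI_bound h
  exact ((integrable_exp_neg_abs (c := b⁻¹ - 2 * |z.im|) (by linarith)).const_mul _).mono'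
    (nI_cont h z).aestronglyMeasurable (Eventually.of_forall fun t => hb z t)

lemma N_eq (h : Hyp b ε) {z : ℂ} (hz : |z.im| < b⁻¹ / 2) :
    (∫ t, nI b ε z t) * (1 + Complex.exp (2 * Real.pi * b * z)) =
      -(2 * Real.pi * Complex.I * b * Complex.exp (2 * Real.pi * b * z)) := by
  have hb := h.hb
  have hb' : (b:ℂ) ≠ 0 := by exact_mod_cast hb.ne'
  have hn : 0 < Real.pi * b - ε := by have := (div_lt_iff₀ hb).1 h.h2; linarith
  set f : ℂ → ℂ := fun T => Complex.exp (-(2 * Complex.I * T * z)) / Complex.sinh (T / b) with hf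
  have hI : ∀ t : ℝ, f (t + ε * Complex.I) = nI b ε z t := fun t => by
    simp only [hf, nI, mul_comm (ε:ℂ)]
  have hI2 : ∀ t : ℝ, f (t + (-(Real.pi * b - ε) : ℝ) * Complex.I) =
      -Complex.exp (-(2 * Real.pi * b * z)) * nI b ε z t := fun t => by
    simp only [hf, nI]
    have e1 : ((t:ℂ) + (-(Real.pi * b - ε) : ℝ) * Complex.I) / b =
        (t + Complex.I * ε) / b - Real.pi * Complex.I := by
      push_cast; field_simp; ring
    have e2 : Complex.exp (-(2 * Complex.I * ((t:ℂ) + (-(Real.pi * b - ε) : ℝ) * Complex.I) * z)) =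
        Complex.exp (-(2 * Real.pi * b * z)) * Complex.exp (-(2 * Complex.I * (t + Complex.I * ε) * z)) := by
      rw [← Complex.exp_add]; congr 1; push_cast
      linear_combination (2 * Real.pi * b * z) * Complex.I_sq
    rw [e1, e2, Complex.sinh_sub, Complex.sinh_mul_I, Complex.cosh_mul_I, Complex.cos_pi, Complex.sin_pi]
    simp only [mul_neg, mul_one, zero_mul, mul_zero, sub_zero, div_neg, neg_mul]
    ring
  have hfar : ∀ R : ℝ, 1 ≤ b⁻¹ * R → ∀ T : ℂ, |T.re| = R → |T.im| ≤ Real.pi * b →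
      ‖f T‖ ≤ 4 * Real.exp (2 * |z.re| * (Real.pi * b)) * Real.exp (-((b⁻¹ - 2 * |z.im|) * R)) := by
    intro R hR2 T hT hT'
    have n2 : Real.exp (b⁻¹ * R) / 4 ≤ ‖Complex.sinh (T / b)‖ := by
      have e : |(T / (b:ℂ)).re| = b⁻¹ * R := by
        rw [← hT]; simp [abs_div, abs_of_pos hb]; field_simp
      have := norm_sinh_far (T / b) (by rw [e]; exact hR2)
      rwa [e] at this
    have n4 : ‖Complex.exp (-(2 * Complex.I * T * z))‖ ≤
        Real.exp (2 * |z.im| * R + 2 * |z.re| * (Real.pi * b)) := by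
      rw [Complex.norm_exp]
      refine Real.exp_le_exp.2 ?_
      have := two_arg_re z T
      rw [hT] at this
      rw [show 2 * Complex.I * T * z = 2 * Complex.I * z * T by ring, Complex.neg_re]
      refine (neg_le_abs _).trans (this.trans ?_)
      gcongr
    simp only [hf]
    rw [norm_div]
    refine (div_le_div₀ (by positivity) n4 (by positivity) n2).trans (le_of_eq ?_)
    rw [div_eq_iff (by positivity)]
    rw [show -((b⁻¹ - 2 * |z.im|) * R) = 2 * |z.im| * R - b⁻¹ * R by ring,
      Real.exp_sub, Real.exp_add]
    field_simp
  have key := contour_residue h.he hn f 0 b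
    (fun T hT h1 h2 => by
      simp only [hf]
      refine DifferentiableAt.div (by fun_prop) ?_ (sinh_ne_zero (div_ne_zero hT hb') ?_)
      · simp only [div_eq_mul_inv]; fun_prop
      · have : (T / (b:ℂ)).im = T.im / b := by simp
        rw [this, abs_div, abs_of_pos hb, div_lt_iff₀ hb, abs_lt]
        have := (div_lt_iff₀ hb).1 h.h2
        have := h.he
        constructor <;> linarith)
    (by
      have hA := lim_sinh (inv_ne_zero hb')
      have hT : Tendsto (fun T : ℂ => T ^ 2) (𝓝[≠] 0) (𝓝 0) := by
        have : Tendsto (fun T : ℂ => T ^ 2) (𝓝 0) (𝓝 (0 ^ 2)) := (continuous_pow 2).tendsto 0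
        rw [zero_pow (by norm_num)] at this
        exact this.mono_left nhdsWithin_le_nhds
      have hS := (hT.mul hA).const_add 1
      rw [zero_mul, add_zero] at hS
      have hE : Tendsto (fun T : ℂ => Complex.exp (-(2 * Complex.I * T * z))) (𝓝[≠] 0) (𝓝 1) := by
        have : Continuous fun T : ℂ => Complex.exp (-(2 * Complex.I * T * z)) := by fun_prop
        have := this.tendsto 0
        simp only [mul_zero, zero_mul, neg_zero, Complex.exp_zero] at this
        exact this.mono_left nhdsWithin_le_nhds
      have := ((hE.const_mul (b:ℂ)).div hS one_ne_zero).sub_const (b:ℂ)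
      simp only [mul_one, div_one, sub_self] at this
      refine this.congr' ?_
      filter_upwards [self_mem_nhdsWithin, hS.eventually_ne one_ne_zero] with T hT0 hd
      have hT0 : T ≠ 0 := hT0
      have s2 : 1 + T ^ 2 * ((Complex.sinh ((b:ℂ)⁻¹ * T) / ((b:ℂ)⁻¹ * T) - 1) / T ^ 2) =
        Complex.sinh ((b:ℂ)⁻¹ * T) / ((b:ℂ)⁻¹ * T) := by field_simp; ring
      rw [s2] at hd
      have hs2 : Complex.sinh ((b:ℂ)⁻¹ * T) ≠ 0 := by rintro h; simp [h] at hd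
      simp only [Pi.div_apply, hf]
      rw [s2, show T / b = (b:ℂ)⁻¹ * T by rw [div_eq_mul_inv, mul_comm]]
      generalize Complex.sinh ((b:ℂ)⁻¹ * T) = S2 at *
      field_simp
      ring)
    (fun R => 4 * Real.exp (2 * |z.re| * (Real.pi * b)) * Real.exp (-((b⁻¹ - 2 * |z.im|) * R)))
    (by
      have : Tendsto (fun R : ℝ => Real.exp (-((b⁻¹ - 2 * |z.im|) * R))) atTop (𝓝 0) :=
        Real.tendsto_exp_neg_atTop_nhds_zero.comp
          (tendsto_id.const_mul_atTop (by linarith : 0 < b⁻¹ - 2 * |z.im|))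
      simpa using this.const_mul (4 * Real.exp (2 * |z.re| * (Real.pi * b))))
    (by
      filter_upwards [eventually_ge_atTop 1,
        (tendsto_id.const_mul_atTop (inv_pos.2 hb)).eventually (eventually_ge_atTop 1)]
        with R h1 h3 y hy1 hy2
      have hy : |y| ≤ Real.pi * b := abs_le.2 ⟨by linarith [h.he], by linarith⟩
      have hR : |R| = R := abs_of_pos (by linarith)
      exact ⟨hfar R h3 _ (by simpa using hR) (by simpa using hy),
        hfar R h3 _ (by simpa using hR) (by simpa using hy)⟩)
    (by simp only [hI]; exact nI_int h hz)
    (by simp only [hI2]; exact (nI_int h hz).const_mul _)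
  simp only [hI, hI2] at key
  rw [integral_const_mul] at key
  have e3 : Complex.exp (2 * Real.pi * b * z) * Complex.exp (-(2 * Real.pi * b * z)) = 1 := by
    rw [← Complex.exp_add, add_neg_cancel, Complex.exp_zero]
  linear_combination Complex.exp (2 * Real.pi * b * z) * key - (∫ t, nI b ε z t) * e3

noncomputable def qL (b ε : ℝ) (z : ℂ) : ℂ := ∫ t : ℝ, nI b ε z t / (2 * ((t:ℂ) + Complex.I * ε))

lemma qL_deriv (h : Hyp b ε) {z : ℂ} (hz : |z.im| < b⁻¹ / 2) :
    HasDerivAt (qL b ε) (-Complex.I * ∫ t, nI b ε z t) z := by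
  obtain ⟨K, hK, hb⟩ := nI_bound h
  set d := (b⁻¹ / 2 - |z.im|) / 2 with hd
  have hd0 : 0 < d := by rw [hd]; linarith
  have he := h.he
  have hcont : ∀ z, Continuous fun t : ℝ => nI b ε z t / (2 * ((t:ℂ) + Complex.I * ε)) := fun z =>
    (nI_cont h z).div (by fun_prop) (fun t => mul_ne_zero two_ne_zero (T_ne h t))
  have := (hasDerivAt_param (isOpen_strip (b⁻¹ / 2))
    (fun z t => nI b ε z t / (2 * ((t:ℂ) + Complex.I * ε))) (fun t => ?_)
    (fun z _ => (hcont z).aestronglyMeasurable) hz ⟨d, hd0,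
      fun t => (K * Real.exp (2 * ε * (z.re + d)) * Real.exp (-((2 * d) * |t|))) / (2 * ε),
      ((integrable_exp_neg_abs (by linarith)).const_mul _).div_const _, fun w _ hw t => ?_⟩)
  · refine this.congr_deriv ?_
    rw [← integral_const_mul]
    refine integral_congr_ae (Eventually.of_forall fun t => ?_)
    have hT := T_ne h t
    have hS := sinh2_ne h t
    simp only [nI]
    have hd1 : HasDerivAt (fun z : ℂ => -(2 * Complex.I * ((t : ℂ) + Complex.I * (ε : ℂ)) * z))
        (-(2 * Complex.I * ((t : ℂ) + Complex.I * (ε : ℂ)) * 1)) z :=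
      ((hasDerivAt_id z).const_mul _).neg
    have hd2 := ((hd1.cexp).div_const (Complex.sinh (((t : ℂ) + Complex.I * (ε : ℂ)) / (b : ℂ)))).div_const
      (2 * ((t:ℂ) + Complex.I * ε))
    rw [hd2.deriv]
    field_simp
  · unfold nI; fun_prop
  · rw [norm_div]
    have hTn : 2 * ε ≤ ‖2 * ((t : ℂ) + Complex.I * (ε : ℂ))‖ := by
      have := Complex.abs_im_le_norm ((t : ℂ) + Complex.I * (ε : ℂ))
      rw [norm_mul, Complex.norm_ofNat]
      simp at this
      linarith [(le_abs_self ε).trans this]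
    have h1 := (Complex.abs_re_le_norm (w - z)).trans hw
    have h2 := (Complex.abs_im_le_norm (w - z)).trans hw
    rw [Complex.sub_re] at h1
    rw [Complex.sub_im] at h2
    have h3 : |w.im| ≤ |z.im| + d := by
      have := abs_sub_abs_le_abs_sub w.im z.im; linarith
    have h4 := (abs_le.1 h1).2
    refine div_le_div₀ (by positivity) ((hb w t).trans ?_) (by positivity) hTn
    refine mul_le_mul (mul_le_mul_of_nonneg_left (Real.exp_le_exp.2 ?_) hK.le)
      (Real.exp_le_exp.2 ?_) (Real.exp_pos _).le (by positivity)
    · gcongr; linarith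
    · rw [neg_le_neg_iff]; gcongr; linarith

lemma qL_const (h : Hyp b ε) {z : ℂ} (hz : |z.im| < b⁻¹ / 2) :
    Complex.exp (qL b ε z) * (1 + Complex.exp (2 * Real.pi * b * z)) = 2 * Complex.exp (qL b ε 0) := by
  have hd : ∀ z ∈ {z : ℂ | |z.im| < b⁻¹ / 2}, HasDerivAt
      (fun z => Complex.exp (qL b ε z) * (1 + Complex.exp (2 * Real.pi * b * z))) 0 z := by
    intro z hz
    have h1 := (qL_deriv h hz).cexp
    have h2 : HasDerivAt (fun z : ℂ => 1 + Complex.exp (2 * Real.pi * b * z))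
      (Complex.exp (2 * Real.pi * b * z) * (2 * Real.pi * b * 1)) z :=
      (((hasDerivAt_id z).const_mul (2 * Real.pi * b : ℂ)).cexp).const_add 1
    refine (h1.mul h2).congr_deriv ?_
    linear_combination (-Complex.I * Complex.exp (qL b ε z)) * N_eq h hz +
      (2 * Real.pi * b * Complex.exp (2 * Real.pi * b * z) * Complex.exp (qL b ε z)) * Complex.I_sq
  have hconv : Convex ℝ {z : ℂ | |z.im| < b⁻¹ / 2} := by
    have : {z : ℂ | |z.im| < b⁻¹ / 2} = Complex.imLm ⁻¹' (Metric.ball 0 (b⁻¹ / 2)) := by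
      ext z; simp
    rw [this]
    exact (convex_ball _ _).linear_preimage _
  have := (isOpen_strip (b⁻¹ / 2)).is_const_of_deriv_eq_zero hconv.isPreconnected
    (fun z hz => (hd z hz).differentiableAt.differentiableWithinAt)
    (fun z hz => (hd z hz).deriv) hz (show (0:ℂ) ∈ {z : ℂ | |z.im| < b⁻¹ / 2} by
      simp; exact h.hb)
  rw [this]
  simp; ring

lemma wb_FE (h : Hyp b ε) : ∃ C : ℂ, C ≠ 0 ∧ ∀ z : ℂ, |z.im| < b⁻¹ / 2 →
    wb b ε (z - Complex.I * b / 2) * (Complex.exp (Real.pi * b * z) + Complex.exp (-(Real.pi * b * z))) =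
      C * wb b ε (z + Complex.I * b / 2) := by
  refine ⟨2 * Complex.exp (qL b ε 0), mul_ne_zero two_ne_zero (Complex.exp_ne_zero _), fun z hz => ?_⟩
  have hb := h.hb
  have i1 : (z - Complex.I * b / 2).im = z.im - b / 2 := by simp
  have i2 : (z + Complex.I * b / 2).im = z.im + b / 2 := by simp
  have hz1 : |(z - Complex.I * b / 2).im| < (b + b⁻¹) / 2 := by
    rw [i1, abs_lt]; rw [abs_lt] at hz; constructor <;> linarith
  have hz2 : |(z + Complex.I * b / 2).im| < (b + b⁻¹) / 2 := by
    rw [i2, abs_lt]; rw [abs_lt] at hz; constructor <;> linarith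
  have hL : qJ b ε (z + Complex.I * b / 2) - qJ b ε (z - Complex.I * b / 2) = qL b ε z := by
    rw [qJ, qJ, ← integral_sub (jI_int h hz2) (jI_int h hz1), qL]
    refine integral_congr_ae (Eventually.of_forall fun t => ?_)
    simp only [jI, nI]
    have hd := den_ne h t
    generalize (t:ℂ) + Complex.I * ε = T at *
    have hd1 := left_ne_zero_of_mul hd
    have hd2 := right_ne_zero_of_mul hd
    have hd3 := left_ne_zero_of_mul hd1
    have hd4 := right_ne_zero_of_mul hd1
    have hd5 := right_ne_zero_of_mul hd3
    have a1 : Complex.exp (-(2 * Complex.I * T * (z + Complex.I * b / 2))) =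
      Complex.exp (-(2 * Complex.I * T * z)) * Complex.exp (b * T) := by
      rw [← Complex.exp_add]; congr 1; linear_combination (-T * b) * Complex.I_sq
    have a2 : Complex.exp (-(2 * Complex.I * T * (z - Complex.I * b / 2))) =
      Complex.exp (-(2 * Complex.I * T * z)) * Complex.exp (-(b * T)) := by
      rw [← Complex.exp_add]; congr 1; linear_combination (T * b) * Complex.I_sq
    rw [a1, a2, ← sub_div, ← mul_sub]
    have a3 : Complex.exp (b * T) - Complex.exp (-(b * T)) = 2 * Complex.sinh (b * T) := by
      rw [Complex.sinh]; ring
    rw [a3]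
    generalize Complex.sinh (b * T) = S1 at *
    generalize Complex.sinh (T / b) = S2 at *
    field_simp
    ring
  have hE : qE b ε (z - Complex.I * b / 2) = qE b ε (z + Complex.I * b / 2) + Real.pi * b * z + qL b ε z := by
    rw [← hL]; unfold qE
    linear_combination (-(Real.pi * b * z)) * Complex.I_sq
  have hc := qL_const h hz
  rw [wb_eq, wb_eq, hE, Complex.exp_add, Complex.exp_add, ← hc]
  have e1 : Complex.exp (2 * Real.pi * b * z) = Complex.exp (Real.pi * b * z) * Complex.exp (Real.pi * b * z) := by
    rw [← Complex.exp_add]; congr 1; ring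
  have e2 : Complex.exp (Real.pi * b * z) * Complex.exp (-(Real.pi * b * z)) = 1 := by
    rw [← Complex.exp_add, add_neg_cancel, Complex.exp_zero]
  rw [e1]
  linear_combination (Complex.exp (qE b ε (z + Complex.I * b / 2)) * Complex.exp (qL b ε z)) * e2

end QD

namespace QD

open Filter Topology Set
variable {b ε : ℝ}

lemma wb_ne (z : ℂ) : wb b ε z ≠ 0 := Complex.exp_ne_zero _

lemma wb_mul_neg (h : Hyp b ε) {z : ℂ} (hz : |z.im| < (b + b⁻¹) / 2) :
    wb b ε z * wb b ε (-z) = 1 := by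
  rw [wb_eq, wb_eq, qE_neg h hz, ← Complex.exp_add, add_neg_cancel, Complex.exp_zero]

lemma wb_zero (h : Hyp b ε) : wb b ε 0 = 1 := by
  have hb := h.hb
  have := qE_neg h (z := 0) (by simp; positivity)
  rw [neg_zero] at this
  rw [wb_eq, show qE b ε 0 = 0 by linear_combination (1/2) * this, Complex.exp_zero]

lemma wb_diff (h : Hyp b ε) {z : ℂ} (hz : |z.im| < (b + b⁻¹) / 2) :
    DifferentiableAt ℂ (wb b ε) z := (qE_diff h hz).cexp

lemma Dfun_wb (h : Hyp b ε) {α z : ℂ} (hz : |z.im| + |α.im| < (b + b⁻¹) / 2) :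
    Dfun b ε α z = wb b ε (α + z) * wb b ε (α - z) := by
  have h2 : |(z - α).im| < (b + b⁻¹) / 2 := by
    rw [Complex.sub_im]; exact (abs_sub _ _).trans_lt hz
  rw [Dfun_eq h hz, wb_eq, wb_eq, ← neg_sub z α, qE_neg h h2, ← Complex.exp_add, ← sub_eq_add_neg,
    add_comm z α]

lemma D_ne (α z : ℂ) : Dfun b ε α z ≠ 0 := Complex.exp_ne_zero _

lemma D_even (h : Hyp b ε) {α z : ℂ} (hz : |z.im| + |α.im| < (b + b⁻¹) / 2) :
    Dfun b ε α (-z) = Dfun b ε α z := by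
  rw [Dfun_wb h hz, Dfun_wb h (by simpa using hz), mul_comm, sub_neg_eq_add, ← sub_eq_add_neg]

lemma D_neg (h : Hyp b ε) {α z : ℂ} (hz : |z.im| + |α.im| < (b + b⁻¹) / 2) :
    Dfun b ε (-α) z * Dfun b ε α z = 1 := by
  rw [Dfun_eq h hz, Dfun_eq h (by simpa using hz), ← Complex.exp_add, ← sub_eq_add_neg, sub_neg_eq_add,
    sub_add_sub_cancel, sub_self, Complex.exp_zero]

lemma D_diff (h : Hyp b ε) {α z : ℂ} (hz : |z.im| + |α.im| < (b + b⁻¹) / 2) :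
    DifferentiableAt ℂ (Dfun b ε α) z := by
  have ho : IsOpen {w : ℂ | |w.im| + |α.im| < (b + b⁻¹) / 2} :=
    isOpen_lt (by fun_prop) continuous_const
  have he : Dfun b ε α =ᶠ[𝓝 z] fun w => wb b ε (α + w) * wb b ε (α - w) := by
    filter_upwards [ho.mem_nhds hz] with w hw using Dfun_wb h hw
  refine DifferentiableAt.congr_of_eventuallyEq ?_ he
  refine DifferentiableAt.mul ?_ ?_
  · refine DifferentiableAt.fun_comp' z (wb_diff h ?_) (by fun_prop)
    rw [Complex.add_im]; refine (abs_add_le _ _).trans_lt (by linarith)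
  · refine DifferentiableAt.fun_comp' z (wb_diff h ?_) (by fun_prop)
    rw [Complex.sub_im]; refine (abs_sub _ _).trans_lt (by linarith)

lemma D_diff_param (h : Hyp b ε) {α z : ℂ} (hz : |z.im| + |α.im| < (b + b⁻¹) / 2) :
    DifferentiableAt ℂ (fun α => Dfun b ε α z) α := by
  have ho : IsOpen {w : ℂ | |z.im| + |w.im| < (b + b⁻¹) / 2} :=
    isOpen_lt (by fun_prop) continuous_const
  have he : (fun α => Dfun b ε α z) =ᶠ[𝓝 α] fun w => wb b ε (w + z) * wb b ε (w - z) := by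
    filter_upwards [ho.mem_nhds hz] with w hw using Dfun_wb h hw
  refine DifferentiableAt.congr_of_eventuallyEq ?_ he
  refine DifferentiableAt.mul ?_ ?_
  · refine DifferentiableAt.fun_comp' α (wb_diff h ?_) (by fun_prop)
    rw [Complex.add_im]; refine (abs_add_le _ _).trans_lt (by linarith)
  · refine DifferentiableAt.fun_comp' α (wb_diff h ?_) (by fun_prop)
    rw [Complex.sub_im]; refine (abs_sub _ _).trans_lt (by linarith)

lemma Dfun_asym (h : Hyp b ε) {α z : ℂ} (hz : |z.im| + |α.im| < (b + b⁻¹) / 2) :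
    Dfun b ε α z = Complex.exp (2 * Real.pi * Complex.I * α * z) *
      Complex.exp (qJ b ε (z - α) - qJ b ε (z + α)) := by
  rw [Dfun_eq h hz, ← Complex.exp_add]; congr 1; unfold qE; ring

lemma qJ_diff_bound (h : Hyp b ε) {m : ℝ} (hm : m < (b + b⁻¹) / 2) : ∃ M : ℝ, 0 ≤ M ∧
    ∀ α z : ℂ, |z.im| + |α.im| ≤ m →
    ‖qJ b ε (z - α) - qJ b ε (z + α)‖ ≤ M * Real.exp (2 * ε * |α.re|) * Real.exp (2 * ε * z.re) := by
  obtain ⟨M, hM, hb⟩ := qJ_bound h hm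
  have he := h.he
  refine ⟨2 * M, by positivity, fun α z hz => ?_⟩
  have h1 := hb (z - α) (by rw [Complex.sub_im]; exact (abs_sub _ _).trans hz)
  have h2 := hb (z + α) (by rw [Complex.add_im]; exact (abs_add_le _ _).trans hz)
  have h3 : Real.exp (2 * ε * (z - α).re) ≤ Real.exp (2 * ε * |α.re|) * Real.exp (2 * ε * z.re) := by
    rw [← Real.exp_add, Complex.sub_re]
    refine Real.exp_le_exp.2 ?_
    have := neg_le_abs α.re
    nlinarith
  have h4 : Real.exp (2 * ε * (z + α).re) ≤ Real.exp (2 * ε * |α.re|) * Real.exp (2 * ε * z.re) := by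
    rw [← Real.exp_add, Complex.add_re]
    refine Real.exp_le_exp.2 ?_
    have := le_abs_self α.re
    nlinarith
  refine (norm_sub_le _ _).trans ?_
  nlinarith [mul_le_mul_of_nonneg_left h3 hM, mul_le_mul_of_nonneg_left h4 hM]

lemma D_bound (h : Hyp b ε) {m : ℝ} (hm : m < (b + b⁻¹) / 2) : ∃ M : ℝ, 0 ≤ M ∧
    ∀ α z : ℂ, |z.im| + |α.im| ≤ m →
    ‖Dfun b ε α z‖ ≤ Real.exp (2 * Real.pi * α.im * |z.re| + 2 * Real.pi * |α.re| * |z.im|) *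
      Real.exp (M * Real.exp (2 * ε * |α.re|)) := by
  obtain ⟨M, hM, hb⟩ := qJ_diff_bound h hm
  have he := h.he
  have key : ∀ α z : ℂ, |z.im| + |α.im| ≤ m → z.re ≤ 0 →
    ‖Dfun b ε α z‖ ≤ Real.exp (2 * Real.pi * α.im * |z.re| + 2 * Real.pi * |α.re| * |z.im|) *
      Real.exp (M * Real.exp (2 * ε * |α.re|)) := by
    intro α z hz hre
    rw [Dfun_asym h (hz.trans_lt hm), norm_mul, Complex.norm_exp]
    refine mul_le_mul (Real.exp_le_exp.2 ?_) ((Complex.norm_exp_le_exp_norm _).trans (Real.exp_le_exp.2 ?_))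
      (norm_nonneg _) (Real.exp_pos _).le
    · have : (2 * Real.pi * Complex.I * α * z).re = -(2 * Real.pi * (α.re * z.im + α.im * z.re)) := by
        simp [Complex.mul_re, Complex.mul_im]; ring
      rw [this, abs_of_nonpos hre]
      have h1 : -(α.re * z.im) ≤ |α.re| * |z.im| := by rw [← abs_mul]; exact neg_le_abs _
      nlinarith [Real.pi_pos]
    · refine (hb α z hz).trans (mul_le_of_le_one_right (by positivity) ?_)
      exact Real.exp_le_one_iff.2 (by nlinarith)
  refine ⟨M, hM, fun α z hz => ?_⟩
  rcases le_total z.re 0 with h0 | h0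
  · exact key α z hz h0
  · have := key α (-z) (by simpa using hz) (by simpa using h0)
    rw [D_even h (hz.trans_lt hm)] at this
    simpa using this

end QD

namespace QD

open Filter Topology Set
variable {b ε : ℝ}

lemma D_bound' (h : Hyp b ε) {m : ℝ} (hm : m < (b + b⁻¹) / 2) (α : ℂ) : ∃ K : ℝ, 0 < K ∧
    ∀ z : ℂ, |z.im| + |α.im| ≤ m →
    ‖Dfun b ε α z‖ ≤ K * Real.exp (2 * Real.pi * α.im * |z.re|) := by
  obtain ⟨M, hM, hb⟩ := D_bound h hm
  refine ⟨Real.exp (2 * Real.pi * |α.re| * m) * Real.exp (M * Real.exp (2 * ε * |α.re|)),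
    by positivity, fun z hz => (hb α z hz).trans ?_⟩
  have e : Real.exp (2 * Real.pi * α.im * |z.re| + 2 * Real.pi * |α.re| * |z.im|) ≤
      Real.exp (2 * Real.pi * α.im * |z.re| + 2 * Real.pi * |α.re| * m) := by
    refine Real.exp_le_exp.2 ?_
    have := abs_nonneg α.im
    have := Real.pi_pos
    gcongr
    linarith
  refine (mul_le_mul_of_nonneg_right e (Real.exp_pos _).le).trans (le_of_eq ?_)
  rw [Real.exp_add]; ring

noncomputable def gI (b ε : ℝ) (α y z : ℂ) : ℂ :=
  Complex.exp (2 * Real.pi * Complex.I * z * y) * Dfun b ε α z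

noncomputable def FT (b ε : ℝ) (α y : ℂ) : ℂ := ∫ x : ℝ, gI b ε α y x

lemma norm_kernel (z y : ℂ) : ‖Complex.exp (2 * Real.pi * Complex.I * z * y)‖ =
    Real.exp (-(2 * Real.pi * (z.re * y.im + z.im * y.re))) := by
  rw [Complex.norm_exp]; congr 1
  simp [Complex.mul_re, Complex.mul_im]; ring

lemma norm_kernel_le (z y : ℂ) : ‖Complex.exp (2 * Real.pi * Complex.I * z * y)‖ ≤
    Real.exp (2 * Real.pi * (|z.re| * |y.im| + |z.im| * |y.re|)) := by
  rw [norm_kernel]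
  refine Real.exp_le_exp.2 ?_
  have h1 : -(z.re * y.im) ≤ |z.re| * |y.im| := by rw [← abs_mul]; exact neg_le_abs _
  have h2 : -(z.im * y.re) ≤ |z.im| * |y.re| := by rw [← abs_mul]; exact neg_le_abs _
  nlinarith [Real.pi_pos]

lemma gI_bound (h : Hyp b ε) {m : ℝ} (hm : m < (b + b⁻¹) / 2) (α : ℂ) : ∃ K : ℝ, 0 < K ∧
    ∀ y z : ℂ, |z.im| + |α.im| ≤ m →
    ‖gI b ε α y z‖ ≤ K * Real.exp (2 * Real.pi * |z.im| * |y.re|) *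
      Real.exp (-((2 * Real.pi * (-α.im - |y.im|)) * |z.re|)) := by
  obtain ⟨K, hK, hb⟩ := D_bound' h hm α
  refine ⟨K, hK, fun y z hz => ?_⟩
  rw [gI, norm_mul]
  refine (mul_le_mul (norm_kernel_le z y) (hb z hz) (norm_nonneg _) (Real.exp_pos _).le).trans
    (le_of_eq ?_)
  rw [mul_assoc K, mul_left_comm, ← Real.exp_add, ← Real.exp_add]
  congr 2; ring

lemma gI_cont (h : Hyp b ε) {α : ℂ} (y : ℂ) {s : ℝ} (hs : |s| + |α.im| < (b + b⁻¹) / 2) :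
    Continuous fun x : ℝ => gI b ε α y (x + s * Complex.I) := by
  refine continuous_iff_continuousAt.2 fun x => ?_
  have hd : ContinuousAt (Dfun b ε α) (x + s * Complex.I) := (D_diff h (by simpa using hs)).continuousAt
  unfold gI
  exact ContinuousAt.mul (by fun_prop) (hd.comp' (f := fun x : ℝ => (x : ℂ) + s * Complex.I) (by fun_prop))

lemma gI_int (h : Hyp b ε) {α y : ℂ} {s : ℝ} (hs : |s| + |α.im| < (b + b⁻¹) / 2)
    (hy : |y.im| < -α.im) : Integrable fun x : ℝ => gI b ε α y (x + s * Complex.I) := by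
  obtain ⟨K, hK, hb⟩ := gI_bound h hs α
  have hp := Real.pi_pos
  refine ((integrable_exp_neg_abs (c := 2 * Real.pi * (-α.im - |y.im|)) ?_).const_mul
    (K * Real.exp (2 * Real.pi * |s| * |y.re|))).mono'
    (gI_cont h y hs).aestronglyMeasurable (Eventually.of_forall fun t => ?_)
  · have : 0 < -α.im - |y.im| := by linarith
    positivity
  · simpa using hb y (t + s * Complex.I) (by simp)

lemma gI_int0 (h : Hyp b ε) {α y : ℂ} (ha : -((b + b⁻¹) / 2) < α.im)
    (hy : |y.im| < -α.im) : Integrable fun x : ℝ => gI b ε α y x := by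
  have h0 : α.im < 0 := by have := abs_nonneg y.im; linarith
  simpa using gI_int h (α := α) (y := y) (s := 0) (by rw [abs_of_neg h0]; simp; linarith) hy

lemma gI_cont0 (h : Hyp b ε) {α : ℂ} (y : ℂ) (ha : |α.im| < (b + b⁻¹) / 2) :
    Continuous fun x : ℝ => gI b ε α y x := by
  simpa using gI_cont h (α := α) y (s := 0) (by simpa using ha)

lemma FT_shift_aux (h : Hyp b ε) {α y : ℂ} {s1 s2 : ℝ} (h12 : s1 ≤ s2)
    (hs1 : |s1| + |α.im| < (b + b⁻¹) / 2) (hs2 : |s2| + |α.im| < (b + b⁻¹) / 2)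
    (hy : |y.im| < -α.im) :
    ∫ x : ℝ, gI b ε α y (x + s2 * Complex.I) = ∫ x : ℝ, gI b ε α y (x + s1 * Complex.I) := by
  set m := max (|s1| + |α.im|) (|s2| + |α.im|) with hm
  have hm' : m < (b + b⁻¹) / 2 := max_lt hs1 hs2
  have hmem : ∀ s, s1 ≤ s → s ≤ s2 → |s| + |α.im| ≤ m := by
    intro s h1 h2
    have := abs_le_max_abs_abs h1 h2
    rw [hm, max_add_add_right]; linarith
  obtain ⟨K, hK, hb⟩ := gI_bound h hm' α
  have hp := Real.pi_pos
  have key := shift_tendsto h12 (gI b ε α y) (fun z h1 h2 => ?_)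
    (fun R => K * Real.exp (2 * Real.pi * m * |y.re|) *
      Real.exp (-((2 * Real.pi * (-α.im - |y.im|)) * R))) ?_ ?_
  · have k2 := (tendsto_int_sym (gI_int h hs2 hy)).sub (tendsto_int_sym (gI_int h hs1 hy))
    exact sub_eq_zero.1 (tendsto_nhds_unique k2 key)
  · unfold gI
    exact DifferentiableAt.mul (by fun_prop) (D_diff h ((hmem _ h1 h2).trans_lt hm'))
  · have : Tendsto (fun R : ℝ => Real.exp (-((2 * Real.pi * (-α.im - |y.im|)) * R))) atTop (𝓝 0) :=
      Real.tendsto_exp_neg_atTop_nhds_zero.comp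
        (tendsto_id.const_mul_atTop (by have : 0 < -α.im - |y.im| := by linarith
                                        positivity))
    simpa using this.const_mul (K * Real.exp (2 * Real.pi * m * |y.re|))
  · filter_upwards [eventually_ge_atTop 0] with R hR s h1 h2
    have hsm := hmem s h1 h2
    have : |s| ≤ m := by have := abs_nonneg α.im; linarith
    constructor
    · refine (hb y _ (by simpa using hsm)).trans ?_
      simp only [Complex.add_re, Complex.ofReal_re, Complex.mul_re, Complex.I_re, mul_zero, Complex.ofReal_im,
        Complex.I_im, mul_one, sub_self, add_zero, Complex.add_im, Complex.mul_im, zero_add, abs_of_nonneg hR]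
      gcongr
    · refine (hb y _ (by simpa using hsm)).trans ?_
      simp only [Complex.add_re, Complex.ofReal_re, Complex.mul_re, Complex.I_re, mul_zero, Complex.ofReal_im,
        Complex.I_im, mul_one, sub_self, add_zero, Complex.add_im, Complex.mul_im, zero_add, abs_neg, abs_of_nonneg hR]
      gcongr

lemma FT_shift (h : Hyp b ε) {α y : ℂ} {s : ℝ} (hs : |s| + |α.im| < (b + b⁻¹) / 2)
    (hy : |y.im| < -α.im) : ∫ x : ℝ, gI b ε α y (x + s * Complex.I) = FT b ε α y := by
  have h0 : |(0:ℝ)| + |α.im| < (b + b⁻¹) / 2 := by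
    have := abs_nonneg s; simp; linarith
  have e : FT b ε α y = ∫ x : ℝ, gI b ε α y (x + (0:ℝ) * Complex.I) := by simp [FT]
  rw [e]
  rcases le_total 0 s with h1 | h1
  · exact FT_shift_aux h h1 h0 hs hy
  · exact (FT_shift_aux h h1 hs h0 hy).symm

lemma FT_bound (h : Hyp b ε) {α : ℂ} (ha : -((b + b⁻¹) / 2) < α.im) (ha' : α.im < 0)
    {s : ℝ} (hs : s < -α.im) : ∃ K : ℝ, 0 < K ∧ ∀ y : ℂ, |y.im| ≤ s → ‖FT b ε α y‖ ≤ K := by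
  have hal : |α.im| < (b + b⁻¹) / 2 := by rw [abs_of_neg ha']; linarith
  obtain ⟨K, hK, hb⟩ := gI_bound h hal α
  have hp := Real.pi_pos
  have hi := integrable_exp_neg_abs (c := 2 * Real.pi * (-α.im - s)) (by
    have : 0 < -α.im - s := by linarith
    positivity)
  have hnn : 0 ≤ ∫ x : ℝ, Real.exp (-(2 * Real.pi * (-α.im - s) * |x|)) :=
    integral_nonneg fun x => (Real.exp_pos _).le
  refine ⟨K * (∫ x : ℝ, Real.exp (-(2 * Real.pi * (-α.im - s) * |x|))) + 1, by positivity, fun y hy => ?_⟩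
  rw [← integral_const_mul]
  refine (norm_integral_le_of_norm_le (hi.const_mul K) (Eventually.of_forall fun x => ?_)).trans (by linarith)
  have := hb y x (by simp)
  simp only [Complex.ofReal_im, abs_zero, mul_zero, zero_mul, Real.exp_zero, mul_one, Complex.ofReal_re] at this
  refine this.trans ?_
  gcongr

lemma FT_diff (h : Hyp b ε) {α y : ℂ} (ha : -((b + b⁻¹) / 2) < α.im) (hy : |y.im| < -α.im) :
    DifferentiableAt ℂ (FT b ε α) y := by
  have ha' : α.im < 0 := by have := abs_nonneg y.im; linarith
  have hal : |α.im| < (b + b⁻¹) / 2 := by rw [abs_of_neg ha']; linarith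
  obtain ⟨K, hK, hb⟩ := gI_bound h hal α
  have hp := Real.pi_pos
  set d := (-α.im - |y.im|) / 2 with hd
  have hd0 : 0 < d := by rw [hd]; linarith
  refine (hasDerivAt_param (isOpen_strip (-α.im)) (fun y x => gI b ε α y x) (fun t => ?_)
    (fun z _ => (gI_cont0 h z hal).aestronglyMeasurable) hy ⟨d, hd0,
      fun t => K * Real.exp (-((2 * Real.pi * d) * |t|)),
      (integrable_exp_neg_abs (by positivity)).const_mul _, fun w _ hw t => ?_⟩).differentiableAt
  · unfold gI; fun_prop
  · have := hb w t (by simp)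
    simp only [Complex.ofReal_im, abs_zero, mul_zero, zero_mul, Real.exp_zero, mul_one, Complex.ofReal_re] at this
    refine this.trans ?_
    have h2 := (Complex.abs_im_le_norm (w - y)).trans hw
    rw [Complex.sub_im] at h2
    have h3 : |w.im| ≤ |y.im| + d := by
      have := abs_sub_abs_le_abs_sub w.im y.im; linarith
    have : d ≤ -α.im - |w.im| := by linarith
    exact mul_le_mul_of_nonneg_left (Real.exp_le_exp.2 (neg_le_neg (mul_le_mul_of_nonneg_right
      (mul_le_mul_of_nonneg_left this (by positivity)) (abs_nonneg t)))) hK.le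

lemma FT_diff_param (h : Hyp b ε) {α y : ℂ} (ha : -((b + b⁻¹) / 2) < α.im) (hy : |y.im| < -α.im) :
    DifferentiableAt ℂ (fun α => FT b ε α y) α := by
  set U : Set ℂ := {α : ℂ | -((b + b⁻¹) / 2) < α.im ∧ |y.im| < -α.im} with hU
  have hUo : IsOpen U := by
    have o1 : IsOpen {α : ℂ | -((b + b⁻¹) / 2) < α.im} := isOpen_lt (by fun_prop) (by fun_prop)
    have o2 : IsOpen {α : ℂ | |y.im| < -α.im} := isOpen_lt (by fun_prop) (by fun_prop)
    exact o1.inter o2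
  have hUa : ∀ w ∈ U, |w.im| < (b + b⁻¹) / 2 := fun w hw => by
    have := abs_nonneg y.im; have := hw.2; have := hw.1
    rw [abs_of_neg (by linarith)]; linarith
  have hp := Real.pi_pos
  have he := h.he
  set d := min ((-α.im - |y.im|) / 2) ((α.im + (b + b⁻¹) / 2) / 2) with hd
  have hd0 : 0 < d := lt_min (by linarith) (by linarith)
  have hd1 : d ≤ (-α.im - |y.im|) / 2 := min_le_left _ _
  have hd2 : d ≤ (α.im + (b + b⁻¹) / 2) / 2 := min_le_right _ _
  obtain ⟨M, hM, hb⟩ := D_bound h (m := (b + b⁻¹) / 2 - d) (by linarith)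
  refine (hasDerivAt_param hUo (fun α x => gI b ε α y x) (fun t => ?_)
    (fun z hz => (gI_cont0 h y (hUa z hz)).aestronglyMeasurable) ⟨ha, hy⟩ ⟨d, hd0,
      fun t => Real.exp (M * Real.exp (2 * ε * (|α.re| + d))) * Real.exp (-((2 * Real.pi * d) * |t|)),
      (integrable_exp_neg_abs (by positivity)).const_mul _, fun w hwU hw t => ?_⟩).differentiableAt
  · unfold gI
    intro w hw
    exact (DifferentiableAt.mul (by fun_prop) (D_diff_param h (by simpa using hUa w hw))).differentiableWithinAt
  · have h2 := (Complex.abs_im_le_norm (w - α)).trans hw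
    have h2' := (Complex.abs_re_le_norm (w - α)).trans hw
    rw [Complex.sub_im] at h2
    rw [Complex.sub_re] at h2'
    have h3 : |w.re| ≤ |α.re| + d := by
      have := abs_sub_abs_le_abs_sub w.re α.re; linarith
    have h4 := (abs_le.1 h2).2
    have h5 := (abs_le.1 h2).1
    have hyn := abs_nonneg y.im
    have hw0 : w.im < 0 := by linarith [hwU.2]
    have := hb w t (by simp only [Complex.ofReal_im, abs_zero, zero_add]; rw [abs_of_neg hw0]; linarith)
    simp only [Complex.ofReal_im, abs_zero, mul_zero, zero_mul, Complex.ofReal_re, add_zero] at this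
    rw [gI, norm_mul]
    refine (mul_le_mul (norm_kernel_le t y) this (norm_nonneg _) (Real.exp_pos _).le).trans ?_
    simp only [Complex.ofReal_im, abs_zero, mul_zero, zero_mul, Complex.ofReal_re, add_zero]
    rw [← mul_assoc, ← Real.exp_add, mul_comm]
    refine mul_le_mul (Real.exp_le_exp.2 ?_) (Real.exp_le_exp.2 ?_) (Real.exp_pos _).le (Real.exp_pos _).le
    · gcongr
    · have : d ≤ -w.im - |y.im| := by linarith
      have := mul_le_mul_of_nonneg_right this (abs_nonneg t)
      nlinarith

end QD

namespace QD

open Filter Topology Set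
variable {b ε : ℝ}

noncomputable def st (b : ℝ) (α : ℂ) : ℂ := -(Complex.I * (((b + b⁻¹) / 2 : ℝ) : ℂ)) - α

lemma st_im (α : ℂ) : (st b α).im = -((b + b⁻¹) / 2) - α.im := by
  simp only [st, Complex.sub_im, Complex.neg_im, Complex.mul_im, Complex.I_re, Complex.I_im,
    Complex.ofReal_re, Complex.ofReal_im]; ring

lemma D_shift (h : Hyp b ε) {C : ℂ} (hC : ∀ z : ℂ, |z.im| < b⁻¹ / 2 →
    wb b ε (z - Complex.I * b / 2) * (Complex.exp (Real.pi * b * z) + Complex.exp (-(Real.pi * b * z))) =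
      C * wb b ε (z + Complex.I * b / 2)) {α : ℂ} (ha : -((b + b⁻¹) / 2) < α.im) (ha' : α.im < -(b/2))
    (x : ℝ) : C * Dfun b ε (α + Complex.I * b / 2) (x + (b/2 : ℝ) * Complex.I) =
      (Complex.exp (Real.pi * b * (x + (α + Complex.I * b / 2))) +
        Complex.exp (-(Real.pi * b * (x + (α + Complex.I * b / 2))))) * Dfun b ε α x := by
  have hb := h.hb
  have i1 : (α + Complex.I * b / 2).im = α.im + b / 2 := by simp
  have hn : |α.im + b/2| < b⁻¹ / 2 := by rw [abs_of_neg (by linarith)]; linarith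
  rw [Dfun_wb h, Dfun_wb h]
  · have := hC (x + (α + Complex.I * b / 2)) (by simpa using hn)
    rw [show (x : ℂ) + (α + Complex.I * b / 2) - Complex.I * b / 2 = α + x by ring,
      show (x : ℂ) + (α + Complex.I * b / 2) + Complex.I * b / 2 =
        α + Complex.I * b / 2 + (x + (b/2:ℝ) * Complex.I) by push_cast; ring] at this
    rw [show α + Complex.I * b / 2 - (x + (b/2 : ℝ) * Complex.I) = α - x by push_cast; ring]
    linear_combination (-wb b ε (α - x)) * this
  · simp only [Complex.ofReal_im, abs_zero, zero_add]; rw [abs_of_neg (by linarith)]; linarith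
  · rw [i1]
    have : ((x:ℂ) + (b/2 : ℝ) * Complex.I).im = b/2 := by simp
    rw [this, abs_of_pos (by positivity)]; linarith

lemma FT_eq1 (h : Hyp b ε) {C : ℂ} (hC : ∀ z : ℂ, |z.im| < b⁻¹ / 2 →
    wb b ε (z - Complex.I * b / 2) * (Complex.exp (Real.pi * b * z) + Complex.exp (-(Real.pi * b * z))) =
      C * wb b ε (z + Complex.I * b / 2)) {α y : ℂ} (ha : -((b + b⁻¹) / 2) < α.im)
    (hy : |y.im| < -α.im - b/2) :
    C * Complex.exp (Real.pi * b * y) * FT b ε (α + Complex.I * b / 2) y =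
      Complex.exp (Real.pi * b * (α + Complex.I * b / 2)) * FT b ε α (y - Complex.I * b / 2) +
      Complex.exp (-(Real.pi * b * (α + Complex.I * b / 2))) * FT b ε α (y + Complex.I * b / 2) := by
  have hb := h.hb
  have hyn := abs_nonneg y.im
  have ha' : α.im < -(b/2) := by linarith
  have i1 : (α + Complex.I * b / 2).im = α.im + b / 2 := by simp
  have hs : |b/2| + |(α + Complex.I * b / 2).im| < (b + b⁻¹) / 2 := by
    rw [i1, abs_of_pos (by positivity), abs_of_neg (by linarith)]; linarith
  have hy' : |y.im| < -(α + Complex.I * b / 2).im := by rw [i1]; linarith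
  have j1 : |(y - Complex.I * b / 2).im| < -α.im := by
    have : (y - Complex.I * b / 2).im = y.im - b/2 := by simp
    rw [this]; refine (abs_sub _ _).trans_lt ?_; rw [abs_of_pos (show 0 < b/2 by positivity)]; linarith
  have j2 : |(y + Complex.I * b / 2).im| < -α.im := by
    have : (y + Complex.I * b / 2).im = y.im + b/2 := by simp
    rw [this]; refine (abs_add_le _ _).trans_lt ?_; rw [abs_of_pos (show 0 < b/2 by positivity)]; linarith
  rw [← FT_shift h hs hy', FT, FT, ← integral_const_mul, ← integral_const_mul, ← integral_const_mul,
    ← integral_add ((gI_int0 h ha j1).const_mul _) ((gI_int0 h ha j2).const_mul _)]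
  refine integral_congr_ae (Eventually.of_forall fun x => ?_)
  have := D_shift h hC ha ha' x
  simp only [gI]
  have e1 : Complex.exp (2 * Real.pi * Complex.I * (x + (b/2 : ℝ) * Complex.I) * y) =
      Complex.exp (2 * Real.pi * Complex.I * x * y) * Complex.exp (-(Real.pi * b * y)) := by
    rw [← Complex.exp_add]; congr 1; push_cast
    linear_combination (Real.pi * b * y) * Complex.I_sq
  have e2 : Complex.exp (2 * Real.pi * Complex.I * x * (y - Complex.I * b / 2)) =
      Complex.exp (2 * Real.pi * Complex.I * x * y) * Complex.exp (Real.pi * b * x) := by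
    rw [← Complex.exp_add]; congr 1
    linear_combination (-(Real.pi * b * x)) * Complex.I_sq
  have e3 : Complex.exp (2 * Real.pi * Complex.I * x * (y + Complex.I * b / 2)) =
      Complex.exp (2 * Real.pi * Complex.I * x * y) * Complex.exp (-(Real.pi * b * x)) := by
    rw [← Complex.exp_add]; congr 1
    linear_combination ((Real.pi * b * x)) * Complex.I_sq
  have e4 : Complex.exp (Real.pi * b * y) * Complex.exp (-(Real.pi * b * y)) = 1 := by
    rw [← Complex.exp_add, add_neg_cancel, Complex.exp_zero]
  rw [mul_add, neg_add, Complex.exp_add, Complex.exp_add] at this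
  rw [e1, e2, e3]
  linear_combination (Complex.exp (2 * Real.pi * Complex.I * x * y)) * this +
    (C * Complex.exp (2 * Real.pi * Complex.I * x * y) *
      Dfun b ε (α + Complex.I * b / 2) (x + (b/2 : ℝ) * Complex.I)) * e4

lemma FT_even (h : Hyp b ε) {α y : ℂ} (ha : |α.im| < (b + b⁻¹) / 2) :
    FT b ε α (-y) = FT b ε α y := by
  rw [FT, FT, ← integral_neg_eq_self (fun x : ℝ => gI b ε α y x)]
  refine integral_congr_ae (Eventually.of_forall fun x => ?_)
  simp only [gI]
  push_cast
  rw [D_even h (by simpa using ha)]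
  congr 2; ring

lemma FT_FE (h : Hyp b ε) {α y : ℂ} (ha : -((b + b⁻¹) / 2) < α.im) (hy : |y.im| < -α.im - b/2) :
    FT b ε α (y - Complex.I * b / 2) / Dfun b ε (st b α) (y - Complex.I * b / 2) =
    FT b ε α (y + Complex.I * b / 2) / Dfun b ε (st b α) (y + Complex.I * b / 2) := by
  obtain ⟨C, hC0, hC⟩ := wb_FE h
  have hb := h.hb
  have hyn := abs_nonneg y.im
  have ha' : α.im < -(b/2) := by linarith
  have hb' : (b:ℂ) ≠ 0 := by exact_mod_cast hb.ne'
  have i1 : (α + Complex.I * b / 2).im = α.im + b / 2 := by simp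
  have hal : |α.im| < (b + b⁻¹) / 2 := by rw [abs_of_neg (by linarith)]; linarith
  have hal' : |(α + Complex.I * b / 2).im| < (b + b⁻¹) / 2 := by
    rw [i1, abs_of_neg (by linarith)]; linarith
  have q1 := FT_eq1 h hC ha hy
  have q2 := FT_eq1 h hC (y := -y) ha (by simpa using hy)
  rw [FT_even h hal', show -y - Complex.I * b / 2 = -(y + Complex.I * b / 2) by ring,
    show -y + Complex.I * b / 2 = -(y - Complex.I * b / 2) by ring, FT_even h hal, FT_even h hal] at q2
  set F1 := FT b ε α (y - Complex.I * b / 2)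
  set F2 := FT b ε α (y + Complex.I * b / 2)
  set s := st b α with hs
  have hsi : s.im = -((b + b⁻¹) / 2) - α.im := st_im α
  have hsn : |s.im| = (b + b⁻¹) / 2 + α.im := by rw [hsi, abs_of_neg (by linarith)]; ring
  have g1 := hC (s + y) (by
    rw [Complex.add_im]; refine (abs_add_le _ _).trans_lt ?_; rw [hsn]; linarith)
  have g2 := hC (s - y) (by
    rw [Complex.sub_im]; refine (abs_sub _ _).trans_lt ?_; rw [hsn]; linarith)
  have hD1 : Dfun b ε s (y - Complex.I * b / 2) =
      wb b ε (s + y - Complex.I * b / 2) * wb b ε (s - y + Complex.I * b / 2) := by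
    rw [Dfun_wb h]
    · congr 2 <;> ring
    · have : (y - Complex.I * b / 2).im = y.im - b/2 := by simp
      rw [this, hsn]
      have := abs_sub y.im (b/2)
      rw [abs_of_pos (show 0 < b/2 by positivity)] at this; linarith
  have hD2 : Dfun b ε s (y + Complex.I * b / 2) =
      wb b ε (s + y + Complex.I * b / 2) * wb b ε (s - y - Complex.I * b / 2) := by
    rw [Dfun_wb h]
    · congr 2 <;> ring
    · have : (y + Complex.I * b / 2).im = y.im + b/2 := by simp
      rw [this, hsn]
      have := abs_add_le y.im (b/2)
      rw [abs_of_pos (show 0 < b/2 by positivity)] at this; linarith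
  rw [hD1, hD2]
  have hp : Complex.exp (Real.pi / 2 * Complex.I) = Complex.I := Complex.exp_pi_div_two_mul_I
  have hn : Complex.exp (-(Real.pi / 2 * Complex.I)) = -Complex.I := by
    rw [Complex.exp_neg, hp, Complex.inv_I]
  set A := Complex.exp (Real.pi * b * (α + Complex.I * b / 2)) with hA
  set A' := Complex.exp (-(Real.pi * b * (α + Complex.I * b / 2))) with hA'
  set Y := Complex.exp (Real.pi * b * y) with hY
  set Y' := Complex.exp (-(Real.pi * b * y)) with hY'
  have hYY : Y * Y' = 1 := by rw [hY, hY', ← Complex.exp_add, add_neg_cancel, Complex.exp_zero]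
  have hmy : Complex.exp (Real.pi * b * -y) = Y' := by rw [hY']; congr 1; ring
  rw [hmy] at q2
  have c0 : (Real.pi : ℂ) * b * s = -(Real.pi / 2 * Complex.I) - Real.pi * b * (α + Complex.I * b / 2) := by
    rw [hs, st]; push_cast; field_simp; ring
  have c1 : Complex.exp (Real.pi * b * (s + y)) = -Complex.I * A' * Y := by
    rw [← hn, hA', hY, ← Complex.exp_add, ← Complex.exp_add]; congr 1; linear_combination c0
  have c2 : Complex.exp (-(Real.pi * b * (s + y))) = Complex.I * A * Y' := by
    rw [← hp, hA, hY', ← Complex.exp_add, ← Complex.exp_add]; congr 1; linear_combination -c0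
  have c3 : Complex.exp (Real.pi * b * (s - y)) = -Complex.I * A' * Y' := by
    rw [← hn, hA', hY', ← Complex.exp_add, ← Complex.exp_add]; congr 1; linear_combination c0
  have c4 : Complex.exp (-(Real.pi * b * (s - y))) = Complex.I * A * Y := by
    rw [← hp, hA, hY, ← Complex.exp_add, ← Complex.exp_add]; congr 1; linear_combination -c0
  rw [c1, c2] at g1
  rw [c3, c4] at g2
  have w1 := wb_ne (b := b) (ε := ε) (s + y - Complex.I * b / 2)
  have w2 := wb_ne (b := b) (ε := ε) (s + y + Complex.I * b / 2)
  have w3 := wb_ne (b := b) (ε := ε) (s - y - Complex.I * b / 2)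
  have w4 := wb_ne (b := b) (ε := ε) (s - y + Complex.I * b / 2)
  generalize wb b ε (s + y - Complex.I * b / 2) = W1 at *
  generalize wb b ε (s + y + Complex.I * b / 2) = W2 at *
  generalize wb b ε (s - y - Complex.I * b / 2) = W3 at *
  generalize wb b ε (s - y + Complex.I * b / 2) = W4 at *
  rw [div_eq_div_iff (mul_ne_zero w1 w4) (mul_ne_zero w2 w3)]
  have hE : -Complex.I * A' * Y + Complex.I * A * Y' ≠ 0 := by
    intro h0; rw [h0, mul_zero] at g1; exact mul_ne_zero hC0 w2 g1.symm
  have hF : F1 * (-Complex.I * A' * Y + Complex.I * A * Y') = F2 * (-Complex.I * A' * Y' + Complex.I * A * Y) := by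
    linear_combination (-Complex.I) * (Y' * q1 - Y * q2)
  have hD : W1 * W4 * (-Complex.I * A' * Y + Complex.I * A * Y') = W2 * W3 * (-Complex.I * A' * Y' + Complex.I * A * Y) := by
    linear_combination W4 * g1 - W2 * g2
  have hE2 : -Complex.I * A' * Y' + Complex.I * A * Y ≠ 0 := by
    intro h0; rw [h0, mul_zero] at g2; exact mul_ne_zero hC0 w4 g2.symm
  refine mul_right_cancel₀ (mul_ne_zero hE hE2) ?_
  linear_combination (W2 * W3 * (-Complex.I * A' * Y' + Complex.I * A * Y)) * hF -
    (F2 * (-Complex.I * A' * Y' + Complex.I * A * Y)) * hD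

end QD

namespace QD

open Filter Topology Set

lemma periodic_ext {p η : ℝ} (hp : 0 < p) (hη : 0 < η) (hηp : η ≤ p / 2) (g : ℂ → ℂ)
    (hd : ∀ z : ℂ, |z.im| < p / 2 + η → DifferentiableAt ℂ g z)
    (hper : ∀ z : ℂ, |z.im| < η → g (z - Complex.I * p / 2) = g (z + Complex.I * p / 2)) :
    ∃ H : ℂ → ℂ, Differentiable ℂ H ∧ (∀ z, ∃ w : ℂ, |w.im| ≤ p / 2 ∧ H z = g w) ∧
      ∀ z : ℂ, |z.im| < p / 2 + η → H z = g z := by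
  set H : ℂ → ℂ := fun z => g (z - Complex.I * p * (round (z.im / p) : ℤ)) with hH
  have hr : ∀ z : ℂ, |z.im - p * (round (z.im / p) : ℤ)| ≤ p / 2 := by
    intro z
    have := abs_sub_round (z.im / p)
    have e : z.im - p * (round (z.im / p) : ℤ) = p * (z.im / p - (round (z.im / p) : ℤ)) := by
      field_simp
    rw [e, abs_mul, abs_of_pos hp]
    nlinarith
  have him : ∀ (z : ℂ) (n : ℤ), (z - Complex.I * p * n).im = z.im - p * n := by
    intro z n; simp
  have key : ∀ (z : ℂ) (n : ℤ), |z.im - p * n| < p / 2 + η → H z = g (z - Complex.I * p * n) := by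
    intro z n hz
    simp only [hH]
    have h1 := hr z
    set k := round (z.im / p) with hk
    rw [abs_lt] at hz
    rw [abs_le] at h1
    have u1 : ((k - n : ℤ) : ℝ) < 2 := by push_cast; nlinarith
    have u2 : (-2 : ℝ) < ((k - n : ℤ) : ℝ) := by push_cast; nlinarith
    have u1' : k - n < 2 := by exact_mod_cast u1
    have u2' : -2 < k - n := by exact_mod_cast u2
    have : k = n ∨ k = n + 1 ∨ k = n - 1 := by omega
    rcases this with e | e | e
    · rw [e]
    · rw [e] at h1 ⊢
      push_cast at h1
      have := hper (z - Complex.I * p * n - Complex.I * p / 2) (by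
        have : (z - Complex.I * p * n - Complex.I * p / 2).im = z.im - p * n - p / 2 := by simp
        rw [this, abs_lt]; constructor <;> linarith)
      rw [show z - Complex.I * p * n - Complex.I * p / 2 - Complex.I * p / 2 =
        z - Complex.I * p * ((n + 1 : ℤ) : ℂ) by push_cast; ring,
        show z - Complex.I * p * n - Complex.I * p / 2 + Complex.I * p / 2 =
        z - Complex.I * p * n by ring] at this
      exact this
    · rw [e] at h1 ⊢
      push_cast at h1
      have := hper (z - Complex.I * p * n + Complex.I * p / 2) (by
        have : (z - Complex.I * p * n + Complex.I * p / 2).im = z.im - p * n + p / 2 := by simp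
        rw [this, abs_lt]; constructor <;> linarith)
      rw [show z - Complex.I * p * n + Complex.I * p / 2 + Complex.I * p / 2 =
        z - Complex.I * p * ((n - 1 : ℤ) : ℂ) by push_cast; ring,
        show z - Complex.I * p * n + Complex.I * p / 2 - Complex.I * p / 2 =
        z - Complex.I * p * n by ring] at this
      exact this.symm
  refine ⟨H, fun z0 => ?_, fun z => ⟨_, by rw [him]; exact hr z, rfl⟩, fun z hz => ?_⟩
  · set n := round (z0.im / p) with hn
    have ho : IsOpen {z : ℂ | |z.im - p * n| < p / 2 + η} := isOpen_lt (by fun_prop) continuous_const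
    have hz0 : |z0.im - p * n| < p / 2 + η := by have := hr z0; linarith
    have : H =ᶠ[𝓝 z0] fun z => g (z - Complex.I * p * n) := by
      filter_upwards [ho.mem_nhds hz0] with z hz using key z n hz
    refine DifferentiableAt.congr_of_eventuallyEq ?_ this
    exact DifferentiableAt.fun_comp' z0 (hd _ (by rw [him]; exact hz0)) (by fun_prop)
  · have := key z 0 (by simpa using hz)
    simpa using this

lemma periodic_liouville {p η c K : ℝ} (hp : 0 < p) (hη : 0 < η) (hηp : η ≤ p / 2)
    (hc : c < Real.pi / p) (h : ℂ → ℂ)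
    (hd : ∀ z : ℂ, |z.im| < p / 2 + η → DifferentiableAt ℂ h z)
    (hper : ∀ z : ℂ, |z.im| < η → h (z - Complex.I * p / 2) = h (z + Complex.I * p / 2))
    (hK : ∀ z : ℂ, |z.im| ≤ p / 2 → ‖h z‖ ≤ K * Real.exp (c * |z.re|)) :
    ∀ z : ℂ, |z.im| < p / 2 + η → h z = h 0 := by
  have hpi := Real.pi_pos
  have hp' : (p:ℂ) ≠ 0 := by exact_mod_cast hp.ne'
  set lam : ℝ := Real.pi / p with hlam
  have hlam0 : 0 < lam := by positivity
  have hlamp : lam * p = Real.pi := by rw [hlam]; field_simp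
  set s : ℂ → ℂ := fun z => Complex.sinh (lam * z) with hs
  have hsd : Differentiable ℂ s := by intro z; simp only [hs]; fun_prop
  have hs0 : s 0 = 0 := by simp [hs]
  have hsne : ∀ z : ℂ, z ≠ 0 → |z.im| < p / 2 + η → s z ≠ 0 := by
    intro z hz hzi
    refine sinh_ne_zero (mul_ne_zero (by exact_mod_cast hlam0.ne') hz) ?_
    have : ((lam:ℂ) * z).im = lam * z.im := by simp
    rw [this, abs_mul, abs_of_pos hlam0, ← hlamp]
    gcongr; linarith
  have hsder : deriv s 0 = lam := by
    have : HasDerivAt s (Complex.cosh (lam * 0) * (lam * 1)) 0 := by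
      have := ((hasDerivAt_id (0:ℂ)).const_mul (lam:ℂ)).csinh
      exact this
    rw [this.deriv]; simp
  set g : ℂ → ℂ := fun z => dslope h 0 z / dslope s 0 z with hg
  have hgz : ∀ z : ℂ, z ≠ 0 → g z = (h z - h 0) / s z := by
    intro z hz
    simp only [hg]
    rw [dslope_of_ne _ hz, dslope_of_ne _ hz, slope_def_field, slope_def_field, hs0]
    by_cases hsz : s z = 0
    · simp [hsz]
    · simp only [sub_zero]; field_simp
  have hdne : ∀ z : ℂ, |z.im| < p / 2 + η → dslope s 0 z ≠ 0 := by
    intro z hz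
    by_cases h0 : z = 0
    · rw [h0, dslope_same, hsder]; exact_mod_cast hlam0.ne'
    · rw [dslope_of_ne _ h0, slope_def_field, hs0, sub_zero, sub_zero]
      exact div_ne_zero (hsne z h0 hz) h0
  have hopen := isOpen_strip (p / 2 + η)
  have h0mem : {z : ℂ | |z.im| < p / 2 + η} ∈ 𝓝 (0:ℂ) := hopen.mem_nhds (by simp; linarith)
  have hdh : DifferentiableOn ℂ (dslope h 0) {z : ℂ | |z.im| < p / 2 + η} :=
    (Complex.differentiableOn_dslope h0mem).2 fun z hz => (hd z hz).differentiableWithinAt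
  have hds : DifferentiableOn ℂ (dslope s 0) {z : ℂ | |z.im| < p / 2 + η} :=
    (Complex.differentiableOn_dslope h0mem).2 hsd.differentiableOn
  have hgd : ∀ z : ℂ, |z.im| < p / 2 + η → DifferentiableAt ℂ g z := fun z hz =>
    (hdh.differentiableAt (hopen.mem_nhds hz)).div (hds.differentiableAt (hopen.mem_nhds hz)) (hdne z hz)
  have hsanti : ∀ z : ℂ, s (z - Complex.I * p / 2) = - s (z + Complex.I * p / 2) := by
    intro z
    have e : (lam:ℂ) * (z - Complex.I * p / 2) = lam * (z + Complex.I * p / 2) - Real.pi * Complex.I := by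
      rw [← hlamp]; push_cast; ring
    simp only [hs]
    rw [e, Complex.sinh_sub, Complex.sinh_mul_I, Complex.cosh_mul_I, Complex.cos_pi, Complex.sin_pi]
    ring
  obtain ⟨H, hHd, hHw, hHe⟩ := periodic_ext hp hη hηp (fun z => g z ^ 2)
    (fun z hz => (hgd z hz).pow 2) (fun z hz => by
      have n1 : z - Complex.I * p / 2 ≠ 0 := fun h0 => by
        have : (z - Complex.I * p / 2).im = z.im - p/2 := by simp
        rw [h0] at this; simp at this
        rw [abs_lt] at hz; linarith
      have n2 : z + Complex.I * p / 2 ≠ 0 := fun h0 => by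
        have : (z + Complex.I * p / 2).im = z.im + p/2 := by simp
        rw [h0] at this; simp at this
        rw [abs_lt] at hz; linarith
      rw [hgz _ n1, hgz _ n2, hper z hz, hsanti z, div_neg, neg_sq])
  -- decay
  have hfar : ∀ z : ℂ, |z.im| ≤ p / 2 → 1 ≤ lam * |z.re| →
      ‖g z‖ ≤ 4 * K * Real.exp (-((lam - c) * |z.re|)) + 4 * ‖h 0‖ * Real.exp (-(lam * |z.re|)) := by
    intro z hz h1
    have hz0 : z ≠ 0 := by rintro rfl; simp at h1; linarith
    rw [hgz z hz0, norm_div]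
    have e : |((lam:ℂ) * z).re| = lam * |z.re| := by simp [abs_mul, abs_of_pos hlam0]
    have h2 := norm_sinh_far (lam * z) (by rw [e]; exact h1)
    rw [e] at h2
    have h3 : ‖h z - h 0‖ ≤ K * Real.exp (c * |z.re|) + ‖h 0‖ := (norm_sub_le _ _).trans (by
      have := hK z hz; linarith)
    refine (div_le_div₀ ((norm_nonneg _).trans h3) h3 (by positivity) h2).trans (le_of_eq ?_)
    rw [div_eq_iff (by positivity)]
    rw [show -((lam - c) * |z.re|) = c * |z.re| + -(lam * |z.re|) by ring, Real.exp_add]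
    have : Real.exp (-(lam * |z.re|)) * Real.exp (lam * |z.re|) = 1 := by
      rw [← Real.exp_add, neg_add_cancel, Real.exp_zero]
    linear_combination (-(K * Real.exp (c * |z.re|) + ‖h 0‖)) * this
  have hK0 : 0 ≤ K := by
    have := (norm_nonneg _).trans (hK 0 (by simp; linarith)); simpa using this
  have hlc : 0 < lam - c := by linarith
  have hbd : ∃ B : ℝ, ∀ z : ℂ, |z.im| ≤ p / 2 → ‖g z‖ ≤ B := by
    have hcomp : IsCompact (Icc (-lam⁻¹) lam⁻¹ ×ℂ Icc (-(p/2)) (p/2)) := isCompact_Icc.reProdIm isCompact_Icc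
    obtain ⟨B, hB⟩ := hcomp.exists_bound_of_continuousOn (f := g) (fun z hz => by
      have : |z.im| ≤ p/2 := abs_le.2 hz.2
      exact (hgd z (by linarith)).continuousAt.continuousWithinAt)
    refine ⟨max B (4 * K + 4 * ‖h 0‖), fun z hz => ?_⟩
    by_cases hr : 1 ≤ lam * |z.re|
    · refine le_max_of_le_right ((hfar z hz hr).trans ?_)
      have a1 : Real.exp (-((lam - c) * |z.re|)) ≤ 1 := Real.exp_le_one_iff.2 (by
        have := mul_nonneg hlc.le (abs_nonneg z.re); linarith)
      have a2 : Real.exp (-(lam * |z.re|)) ≤ 1 := Real.exp_le_one_iff.2 (by linarith)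
      have := mul_le_mul_of_nonneg_left a1 hK0
      have := mul_le_mul_of_nonneg_left a2 (norm_nonneg (h 0))
      linarith
    · refine le_max_of_le_left (hB z ⟨?_, abs_le.1 hz⟩)
      push Not at hr
      have : |z.re| ≤ lam⁻¹ := by
        rw [← mul_le_mul_iff_right₀ hlam0, mul_inv_cancel₀ hlam0.ne']; exact hr.le
      exact abs_le.1 this
  obtain ⟨B, hB⟩ := hbd
  have hHb : Bornology.IsBounded (range H) := by
    rw [isBounded_iff_forall_norm_le]
    refine ⟨B ^ 2, ?_⟩
    rintro _ ⟨z, rfl⟩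
    obtain ⟨w, hw, e⟩ := hHw z
    rw [e, norm_pow]
    exact pow_le_pow_left₀ (norm_nonneg _) (hB w hw) 2
  have hlim : Tendsto (fun R : ℝ => H R) atTop (𝓝 0) := by
    have t1 : Tendsto (fun R : ℝ => Real.exp (-((lam - c) * R))) atTop (𝓝 0) :=
      Real.tendsto_exp_neg_atTop_nhds_zero.comp (tendsto_id.const_mul_atTop hlc)
    have t2 : Tendsto (fun R : ℝ => Real.exp (-(lam * R))) atTop (𝓝 0) :=
      Real.tendsto_exp_neg_atTop_nhds_zero.comp (tendsto_id.const_mul_atTop hlam0)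
    have t3 := (t1.const_mul (4 * K)).add (t2.const_mul (4 * ‖h 0‖))
    have t4 : Tendsto (fun R : ℝ => g R) atTop (𝓝 0) := by
      refine squeeze_zero_norm' ?_ (by simpa using t3)
      filter_upwards [eventually_ge_atTop 0,
        (tendsto_id.const_mul_atTop hlam0).eventually (eventually_ge_atTop 1)] with R h0 h1
      have := hfar R (by simp; linarith) (by simpa [abs_of_nonneg h0] using h1)
      simpa [abs_of_nonneg h0] using this
    have t5 := t4.pow 2
    rw [zero_pow two_ne_zero] at t5
    refine t5.congr fun R => ?_
    rw [hHe R (by simp; linarith)]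
  have hHzero : ∀ z, H z = 0 := by
    intro z
    refine tendsto_nhds_unique ?_ hlim
    exact tendsto_const_nhds.congr fun R => hHd.apply_eq_apply_of_bounded hHb z R
  intro z hz
  by_cases h0 : z = 0
  · rw [h0]
  · have := hHzero z
    rw [hHe z hz] at this
    have hg0 : g z = 0 := by simpa using this
    rw [hgz z h0, div_eq_zero_iff] at hg0
    rcases hg0 with h1 | h1
    · exact sub_eq_zero.1 h1
    · exact absurd h1 (hsne z h0 hz)

end QD

namespace QD

open Filter Topology Set
variable {b ε : ℝ}

lemma convex_strip (m : ℝ) : Convex ℝ {z : ℂ | |z.im| < m} := by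
  have : {z : ℂ | |z.im| < m} = Complex.imLm ⁻¹' (Metric.ball 0 m) := by
    ext z; simp
  rw [this]
  exact (convex_ball _ _).linear_preimage _

lemma FT_const (h : Hyp b ε) {α : ℂ} (ha : -((b + b⁻¹) / 2) < α.im) (ha' : α.im < -(b/2)) :
    ∃ c : ℂ, ∀ y : ℂ, |y.im| < -α.im → FT b ε α y = c * Dfun b ε (st b α) y := by
  have hb := h.hb
  have hbi := inv_pos.2 hb
  have hpi := Real.pi_pos
  have hsi : (st b α).im = -((b + b⁻¹) / 2) - α.im := st_im α
  have hsn : |(st b α).im| = (b + b⁻¹) / 2 + α.im := by rw [hsi, abs_of_neg (by linarith)]; ring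
  set η := min (-α.im - b/2) (b/2) with hη
  have hη0 : 0 < η := lt_min (by linarith) (by linarith)
  have hη1 : η ≤ -α.im - b/2 := min_le_left _ _
  have hη2 : η ≤ b/2 := min_le_right _ _
  obtain ⟨K1, hK1, hF⟩ := FT_bound h ha (by linarith) (s := b/2) (by linarith)
  have hm : b/2 + ((b + b⁻¹) / 2 + α.im) < (b + b⁻¹) / 2 := by linarith
  obtain ⟨K2, hK2, hD⟩ := D_bound' h hm (-(st b α))
  have hL := periodic_liouville hb hη0 hη2 (c := 2 * Real.pi * ((b + b⁻¹) / 2 + α.im)) (K := K1 * K2)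
    (by rw [lt_div_iff₀ hb]
        have : 2 * ((b + b⁻¹) / 2 + α.im) * b < 1 := by
          have : 2 * ((b + b⁻¹) / 2 + α.im) < b⁻¹ := by linarith
          calc _ < b⁻¹ * b := by gcongr
            _ = 1 := by field_simp
        nlinarith)
    (fun y => FT b ε α y / Dfun b ε (st b α) y)
    (fun z hz => (FT_diff h ha (by linarith)).div (D_diff h (by rw [hsn]; linarith)) (D_ne _ _))
    (fun z hz => FT_FE h ha (by linarith))
    (fun z hz => by
      have e : FT b ε α z / Dfun b ε (st b α) z = FT b ε α z * Dfun b ε (-(st b α)) z := by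
        rw [div_eq_iff (D_ne _ _), mul_assoc, D_neg h (by rw [hsn]; linarith), mul_one]
      rw [e, norm_mul, mul_assoc]
      have := hD z (by rw [Complex.neg_im, abs_neg, hsn]; linarith)
      rw [Complex.neg_im, hsi] at this
      refine mul_le_mul (hF z hz) (this.trans (le_of_eq ?_)) (norm_nonneg _) hK1.le
      congr 2; ring)
  refine ⟨FT b ε α 0 / Dfun b ε (st b α) 0, fun y hy => ?_⟩
  have ho := isOpen_strip (-α.im)
  have hA : AnalyticOnNhd ℂ (FT b ε α) {z : ℂ | |z.im| < -α.im} :=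
    DifferentiableOn.analyticOnNhd (fun z hz => (FT_diff h ha hz).differentiableWithinAt) ho
  have hB : AnalyticOnNhd ℂ (fun y => FT b ε α 0 / Dfun b ε (st b α) 0 * Dfun b ε (st b α) y)
      {z : ℂ | |z.im| < -α.im} :=
    DifferentiableOn.analyticOnNhd (fun z hz => by
      have hz : |z.im| < -α.im := hz
      exact ((D_diff h (by rw [hsn]; linarith)).const_mul _).differentiableWithinAt) ho
  have h0 : (0:ℂ) ∈ {z : ℂ | |z.im| < -α.im} := by simp; linarith
  refine hA.eqOn_of_preconnected_of_eventuallyEq hB (convex_strip _).isPreconnected h0 ?_ hy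
  filter_upwards [(isOpen_strip (b/2 + η)).mem_nhds (show (0:ℂ) ∈ {z : ℂ | |z.im| < b/2 + η} by
    simp; linarith)] with z hz
  have := hL z hz
  rw [← this, div_mul_cancel₀ _ (D_ne _ _)]

/-- residue of `w` -/
lemma wb_res (h : Hyp b ε) : ∃ r : ℂ, r ≠ 0 ∧
    Tendsto (fun d : ℝ => (d:ℂ) * wb b ε (-(Complex.I * (((b + b⁻¹) / 2 : ℝ) : ℂ)) + Complex.I * d))
      (𝓝[>] 0) (𝓝 r) := by
  obtain ⟨C, hC0, hC⟩ := wb_FE h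
  have hb := h.hb
  have hbi := inv_pos.2 hb
  have hpi := Real.pi_pos
  have hpb : Real.pi * b ≠ 0 := by positivity
  have hb' : (b:ℂ) ≠ 0 := by exact_mod_cast hb.ne'
  set z0 : ℂ := Complex.I * (((b - b⁻¹) / 2 : ℝ) : ℂ) with hz0
  refine ⟨C * wb b ε z0 * ((2 * (Real.pi * b) : ℝ) : ℂ)⁻¹, mul_ne_zero (mul_ne_zero hC0 (wb_ne _))
    (inv_ne_zero (by exact_mod_cast (by positivity))), ?_⟩
  have t1 : Tendsto (fun d : ℝ => wb b ε (z0 + Complex.I * d)) (𝓝[>] 0) (𝓝 (wb b ε z0)) := by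
    have hc : ContinuousAt (wb b ε) z0 := (wb_diff h (by
      simp only [hz0, Complex.mul_im, Complex.I_re, Complex.I_im, Complex.ofReal_re, Complex.ofReal_im,
        mul_zero, one_mul, zero_add]
      rw [abs_lt]; constructor <;> linarith)).continuousAt
    have : Tendsto (fun d : ℝ => z0 + Complex.I * d) (𝓝[>] 0) (𝓝 z0) := by
      have : Continuous (fun d : ℝ => z0 + Complex.I * d) := by fun_prop
      have := this.tendsto 0
      simp only [Complex.ofReal_zero, mul_zero, add_zero] at this
      exact this.mono_left nhdsWithin_le_nhds
    exact hc.tendsto.comp this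
  have t2 : Tendsto (fun d : ℝ => d / (2 * Real.sin (Real.pi * b * d))) (𝓝[>] 0) (𝓝 (2 * (Real.pi * b))⁻¹) := by
    have hd : HasDerivAt (fun d : ℝ => 2 * Real.sin (Real.pi * b * d)) (2 * (Real.pi * b)) 0 := by
      have := (((hasDerivAt_id (0:ℝ)).const_mul (Real.pi * b)).sin).const_mul 2
      simpa using this
    have := (hd.tendsto_slope_zero_right).inv₀ (by positivity)
    refine this.congr fun d => ?_
    simp; ring
  have t3 : Tendsto (fun d : ℝ => ((d / (2 * Real.sin (Real.pi * b * d)) : ℝ) : ℂ)) (𝓝[>] 0)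
      (𝓝 (((2 * (Real.pi * b) : ℝ) : ℂ)⁻¹)) := by
    have := (Complex.continuous_ofReal.tendsto _).comp t2
    rw [Complex.ofReal_inv] at this
    exact this
  refine ((t1.const_mul C).mul t3).congr' ?_
  have hev : ∀ᶠ d : ℝ in 𝓝[>] 0, d < b⁻¹ := nhdsWithin_le_nhds (Iio_mem_nhds hbi)
  filter_upwards [hev, self_mem_nhdsWithin] with d hd1 hd0
  have hd0 : 0 < d := hd0
  have hsin : 0 < Real.sin (Real.pi * b * d) := by
    refine Real.sin_pos_of_pos_of_lt_pi (by positivity) ?_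
    calc Real.pi * b * d < Real.pi * b * b⁻¹ := by gcongr
      _ = Real.pi := by field_simp
  have hsin' : (Real.sin (Real.pi * b * d) : ℂ) ≠ 0 := by exact_mod_cast hsin.ne'
  have hh := hC (Complex.I * ((-(b⁻¹/2) + d : ℝ) : ℂ)) (by
    simp only [Complex.mul_im, Complex.I_re, Complex.I_im, Complex.ofReal_re, Complex.ofReal_im,
        mul_zero, one_mul, zero_add]
    rw [abs_lt]; constructor <;> linarith)
  have e1 : Complex.I * ((-(b⁻¹/2) + d : ℝ) : ℂ) - Complex.I * b / 2 =
    -(Complex.I * (((b + b⁻¹) / 2 : ℝ) : ℂ)) + Complex.I * d := by push_cast; ring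
  have e2 : Complex.I * ((-(b⁻¹/2) + d : ℝ) : ℂ) + Complex.I * b / 2 = z0 + Complex.I * d := by
    rw [hz0]; push_cast; ring
  have e3 : Complex.exp (Real.pi * b * (Complex.I * ((-(b⁻¹/2) + d : ℝ) : ℂ))) +
      Complex.exp (-(Real.pi * b * (Complex.I * ((-(b⁻¹/2) + d : ℝ) : ℂ)))) =
      ((2 * Real.sin (Real.pi * b * d) : ℝ) : ℂ) := by
    have : Real.sin (Real.pi * b * d) = Real.cos (Real.pi * b * d - Real.pi / 2) := by
      rw [Real.cos_sub_pi_div_two]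
    rw [this]
    push_cast
    rw [Complex.two_cos]
    congr 2
    · field_simp; ring
    · field_simp; ring
  rw [e1, e2, e3] at hh
  push_cast at hh ⊢
  rw [← hh]
  push_cast at hsin'
  generalize wb b ε (-(Complex.I * ((↑b + (↑b)⁻¹) / 2)) + Complex.I * ↑d) = W
  generalize Complex.sin (↑Real.pi * ↑b * ↑d) = S at *
  field_simp

lemma phi_bound (h : Hyp b ε) {α : ℂ} (ha : -((b + b⁻¹) / 2) < α.im) (ha' : α.im < 0) :
    ∃ K : ℝ, 0 < K ∧ (∀ x : ℝ, x ≤ 0 → ‖Complex.exp (-(2 * Real.pi * Complex.I * α * x)) * Dfun b ε α x‖ ≤ K) ∧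
      (∀ x : ℝ, 0 ≤ x → ‖Complex.exp (-(2 * Real.pi * Complex.I * α * x)) * Dfun b ε α x‖ ≤
        K * Real.exp (4 * Real.pi * α.im * x)) := by
  have hal : |α.im| < (b + b⁻¹) / 2 := by rw [abs_of_neg ha']; linarith
  obtain ⟨K, hK, hb⟩ := D_bound' h hal α
  have hn : ∀ x : ℝ, ‖Complex.exp (-(2 * Real.pi * Complex.I * α * x))‖ = Real.exp (2 * Real.pi * α.im * x) := by
    intro x
    rw [Complex.norm_exp]; congr 1; simp [Complex.mul_re, Complex.mul_im]
  refine ⟨K, hK, fun x hx => ?_, fun x hx => ?_⟩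
  · rw [norm_mul, hn]
    have := mul_le_mul_of_nonneg_left (hb x (by simp)) (Real.exp_pos (2 * Real.pi * α.im * x)).le
    refine this.trans (le_of_eq ?_)
    rw [Complex.ofReal_re, abs_of_nonpos hx, mul_left_comm, ← Real.exp_add]
    ring_nf; simp
  · rw [norm_mul, hn]
    have := mul_le_mul_of_nonneg_left (hb x (by simp)) (Real.exp_pos (2 * Real.pi * α.im * x)).le
    refine this.trans (le_of_eq ?_)
    rw [Complex.ofReal_re, abs_of_nonneg hx, mul_left_comm, ← Real.exp_add]
    ring_nf

lemma phi_lim (h : Hyp b ε) {α : ℂ} (ha : |α.im| < (b + b⁻¹) / 2) :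
    Tendsto (fun x : ℝ => Complex.exp (-(2 * Real.pi * Complex.I * α * x)) * Dfun b ε α x) atBot (𝓝 1) := by
  obtain ⟨M, hM, hb⟩ := qJ_diff_bound h ha
  have he := h.he
  have e : ∀ x : ℝ, Complex.exp (-(2 * Real.pi * Complex.I * α * x)) * Dfun b ε α x =
      Complex.exp (qJ b ε (x - α) - qJ b ε (x + α)) := by
    intro x
    rw [Dfun_asym h (by simpa using ha), ← mul_assoc, ← Complex.exp_add, neg_add_cancel, Complex.exp_zero, one_mul]
  simp only [e]
  have : Tendsto (fun x : ℝ => qJ b ε (x - α) - qJ b ε (x + α)) atBot (𝓝 0) := by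
    refine squeeze_zero_norm (fun x => hb α x (by simp)) ?_
    have : Tendsto (fun x : ℝ => Real.exp (2 * ε * x)) atBot (𝓝 0) :=
      Real.tendsto_exp_atBot.comp (tendsto_id.const_mul_atBot (by positivity))
    simpa using this.const_mul (M * Real.exp (2 * ε * |α.re|))
  have := (Complex.continuous_exp.tendsto 0).comp this
  rw [Complex.exp_zero] at this
  exact this

lemma FT_res (h : Hyp b ε) {α : ℂ} (ha : -((b + b⁻¹) / 2) < α.im) (ha' : α.im < 0) :
    Tendsto (fun d : ℝ => (d:ℂ) * FT b ε α (-α - Complex.I * d)) (𝓝[>] 0) (𝓝 (((2 * Real.pi)⁻¹ : ℝ) : ℂ)) := by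
  have hal : |α.im| < (b + b⁻¹) / 2 := by rw [abs_of_neg ha']; linarith
  have hpi := Real.pi_pos
  obtain ⟨K, hK, hb1, hb2⟩ := phi_bound h ha ha'
  set φ : ℝ → ℂ := fun x => Complex.exp (-(2 * Real.pi * Complex.I * α * x)) * Dfun b ε α x with hφ
  have hφc : Continuous φ := by
    have := gI_cont0 h (-α) hal
    refine this.congr fun x => ?_
    simp only [gI, hφ]; congr 2; ring
  have h1 : ∀ᶠ d : ℝ in 𝓝[>] 0, (∫ s : ℝ, ((Real.exp (2 * Real.pi * s) : ℝ) : ℂ) * φ (s / d)) =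
      (d:ℂ) * FT b ε α (-α - Complex.I * d) := by
    filter_upwards [self_mem_nhdsWithin] with d hd
    have hd : 0 < d := hd
    have := Measure.integral_comp_div (fun x : ℝ => ((Real.exp (2 * Real.pi * (d * x)) : ℝ) : ℂ) * φ x) d
    rw [abs_of_pos hd, Complex.real_smul] at this
    rw [FT]
    convert this using 2
    · ext s; congr 3; field_simp
    · congr 1
      ext x
      simp only [gI, hφ]
      rw [← mul_assoc, Complex.ofReal_exp, ← Complex.exp_add]
      congr 2
      push_cast
      linear_combination (-(2 * Real.pi * x * d)) * Complex.I_sq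
  refine Tendsto.congr' h1 ?_
  have hlim : (((2 * Real.pi)⁻¹ : ℝ) : ℂ) = ∫ s : ℝ, (Iio (0:ℝ)).indicator
      (fun s => ((Real.exp (2 * Real.pi * s) : ℝ) : ℂ)) s := by
    rw [integral_indicator measurableSet_Iio, ← integral_Iic_eq_integral_Iio, integral_complex_ofReal,
      integral_exp_mul_Iic (by positivity)]
    simp
  rw [hlim]
  refine tendsto_integral_filter_of_dominated_convergence (fun s => K * Real.exp (-(2 * Real.pi * |s|))) ?_ ?_
    ((integrable_exp_neg_abs (by positivity)).const_mul K) ?_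
  · refine Eventually.of_forall fun d => Continuous.aestronglyMeasurable ?_
    have : Continuous fun s : ℝ => φ (s / d) := hφc.comp (by fun_prop)
    fun_prop
  · have hev : ∀ᶠ d : ℝ in 𝓝[>] 0, d < -α.im := nhdsWithin_le_nhds (Iio_mem_nhds (by linarith))
    filter_upwards [self_mem_nhdsWithin, hev] with d hd hd1
    have hd : 0 < d := hd
    refine Eventually.of_forall fun s => ?_
    rw [norm_mul, Complex.norm_real, Real.norm_of_nonneg (Real.exp_pos _).le]
    rcases le_total s 0 with hs | hs
    · rw [abs_of_nonpos hs, mul_comm K]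
      refine mul_le_mul (Real.exp_le_exp.2 (by linarith)) (hb1 _ (div_nonpos_of_nonpos_of_nonneg hs hd.le))
        (norm_nonneg _) (Real.exp_pos _).le
    · rw [abs_of_nonneg hs]
      refine (mul_le_mul_of_nonneg_left (hb2 _ (div_nonneg hs hd.le)) (Real.exp_pos _).le).trans ?_
      rw [mul_left_comm, ← Real.exp_add]
      refine mul_le_mul_of_nonneg_left (Real.exp_le_exp.2 ?_) hK.le
      have : s ≤ (-α.im) * (s / d) := by
        rw [mul_div_assoc', le_div_iff₀ hd]; nlinarith
      nlinarith
  · have hne : ∀ᵐ s : ℝ, s ≠ 0 := by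
      simp [ae_iff]
    filter_upwards [hne] with s hs
    rcases lt_or_gt_of_ne hs with hs | hs
    · rw [indicator_of_mem (show s ∈ Iio (0:ℝ) from hs)]
      have t : Tendsto (fun d : ℝ => s / d) (𝓝[>] 0) atBot := by
        simp only [div_eq_mul_inv]
        exact tendsto_inv_nhdsGT_zero.const_mul_atTop_of_neg hs
      have := ((phi_lim h hal).comp t).const_mul (((Real.exp (2 * Real.pi * s) : ℝ) : ℂ))
      rw [mul_one] at this
      exact this
    · rw [indicator_of_notMem (show s ∉ Iio (0:ℝ) from by simp; exact hs.le)]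
      have t : Tendsto (fun d : ℝ => s / d) (𝓝[>] 0) atTop := by
        simp only [div_eq_mul_inv]
        exact tendsto_inv_nhdsGT_zero.const_mul_atTop hs
      have t2 : Tendsto φ atTop (𝓝 0) := by
        refine squeeze_zero_norm' (a := fun x => K * Real.exp (4 * Real.pi * α.im * x)) ?_ ?_
        · filter_upwards [eventually_ge_atTop 0] with x hx using hb2 x hx
        · have : Tendsto (fun x : ℝ => Real.exp (4 * Real.pi * α.im * x)) atTop (𝓝 0) :=
            Real.tendsto_exp_atBot.comp (tendsto_id.const_mul_atTop_of_neg (by nlinarith))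
          simpa using this.const_mul K
      have := (t2.comp t).const_mul (((Real.exp (2 * Real.pi * s) : ℝ) : ℂ))
      simpa using this

end QD

namespace QD

open Filter Topology Set
variable {b ε : ℝ}

noncomputable def iq (b : ℝ) : ℂ := Complex.I * (((b + b⁻¹) / 2 : ℝ) : ℂ)

lemma iq_im : (iq b).im = (b + b⁻¹) / 2 := by
  simp only [iq, Complex.mul_im, Complex.I_re, Complex.I_im, Complex.ofReal_re, Complex.ofReal_im]; ring

lemma st_eq (α : ℂ) : st b α = -iq b - α := rfl

lemma two_im (α : ℂ) : (2 * α + iq b).im = 2 * α.im + (b + b⁻¹) / 2 := by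
  rw [Complex.add_im, iq_im]; simp

lemma FT_kappa_aux (h : Hyp b ε) : ∃ κ : ℂ, ∀ α : ℂ, -((b + b⁻¹) / 2) < α.im → α.im < -(b/2) →
    ∀ y : ℂ, |y.im| < -α.im → FT b ε α y = κ * wb b ε (2 * α + iq b) * Dfun b ε (st b α) y := by
  obtain ⟨r, hr0, hr⟩ := wb_res h
  have hpi := Real.pi_pos
  have hb := h.hb
  refine ⟨(((2 * Real.pi)⁻¹ : ℝ) : ℂ) / r, fun α ha ha' y hy => ?_⟩
  obtain ⟨c, hc⟩ := FT_const h ha ha'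
  rw [hc y hy]
  congr 1
  have hw : |(2 * α + iq b).im| < (b + b⁻¹) / 2 := by
    rw [two_im, abs_lt]; constructor <;> linarith
  have t1 : Tendsto (fun d : ℝ => wb b ε (-(2 * α + iq b) - Complex.I * d)) (𝓝[>] 0)
      (𝓝 (wb b ε (-(2 * α + iq b)))) := by
    have hcont : ContinuousAt (wb b ε) (-(2 * α + iq b)) :=
      (wb_diff h (by rwa [Complex.neg_im, abs_neg])).continuousAt
    have : Tendsto (fun d : ℝ => -(2 * α + iq b) - Complex.I * d) (𝓝[>] 0) (𝓝 (-(2 * α + iq b))) := by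
      have : Continuous (fun d : ℝ => -(2 * α + iq b) - Complex.I * d) := by fun_prop
      have := this.tendsto 0
      simp only [Complex.ofReal_zero, mul_zero, sub_zero] at this
      exact this.mono_left nhdsWithin_le_nhds
    exact hcont.tendsto.comp this
  have t2 := (t1.mul hr).const_mul c
  have t3 := FT_res h ha (by linarith)
  have hsn : |(st b α).im| = (b + b⁻¹) / 2 + α.im := by
    rw [st_im, abs_of_neg (by linarith)]; ring
  have key : c * (wb b ε (-(2 * α + iq b)) * r) = (((2 * Real.pi)⁻¹ : ℝ) : ℂ) := by
    refine tendsto_nhds_unique t2 (t3.congr' ?_)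
    have hev : ∀ᶠ d : ℝ in 𝓝[>] 0, d < -α.im := nhdsWithin_le_nhds (Iio_mem_nhds (by linarith))
    filter_upwards [self_mem_nhdsWithin, hev] with d hd hd1
    have hd : 0 < d := hd
    have hi : |(-α - Complex.I * d).im| < -α.im := by
      have : (-α - Complex.I * d).im = -α.im - d := by simp
      rw [this, abs_of_pos (by linarith)]; linarith
    rw [hc _ hi, Dfun_wb h (by rw [hsn]; linarith), st_eq]
    rw [show -iq b - α + (-α - Complex.I * d) = -(2 * α + iq b) - Complex.I * d by ring,
      show -iq b - α - (-α - Complex.I * d) = -iq b + Complex.I * d by ring]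
    simp only [iq]
    ring
  have hm := wb_mul_neg h hw
  rw [div_mul_eq_mul_div, eq_div_iff hr0, ← key]
  linear_combination (-c * r) * hm

lemma FT_kappa (h : Hyp b ε) : ∃ κ : ℂ, ∀ α : ℂ, -((b + b⁻¹) / 2) < α.im →
    ∀ y : ℂ, |y.im| < -α.im → FT b ε α y = κ * wb b ε (2 * α + iq b) * Dfun b ε (st b α) y := by
  obtain ⟨κ, hκ⟩ := FT_kappa_aux h
  have hb := h.hb
  have hbi := inv_pos.2 hb
  refine ⟨κ, fun α ha y hy => ?_⟩
  set U : Set ℂ := {α : ℂ | -((b + b⁻¹) / 2) < α.im ∧ |y.im| < -α.im} with hU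
  have hUo : IsOpen U := by
    have o1 : IsOpen {α : ℂ | -((b + b⁻¹) / 2) < α.im} := isOpen_lt (by fun_prop) (by fun_prop)
    have o2 : IsOpen {α : ℂ | |y.im| < -α.im} := isOpen_lt (by fun_prop) (by fun_prop)
    exact o1.inter o2
  have hUc : Convex ℝ U := by
    have : U = Complex.imLm ⁻¹' (Ioo (-((b + b⁻¹) / 2)) (-|y.im|)) := by
      ext z; simp [hU, lt_neg]
    rw [this]
    exact (convex_Ioo _ _).linear_preimage _
  have hyn := abs_nonneg y.im
  have hA : AnalyticOnNhd ℂ (fun α => FT b ε α y) U :=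
    DifferentiableOn.analyticOnNhd (fun z hz => (FT_diff_param h hz.1 hz.2).differentiableWithinAt) hUo
  have hB : AnalyticOnNhd ℂ (fun α => κ * wb b ε (2 * α + iq b) * Dfun b ε (st b α) y) U := by
    refine DifferentiableOn.analyticOnNhd (fun z hz => DifferentiableAt.differentiableWithinAt ?_) hUo
    obtain ⟨h1, h2⟩ := hz
    refine DifferentiableAt.mul (DifferentiableAt.const_mul ?_ _) ?_
    · refine DifferentiableAt.fun_comp' z (wb_diff h ?_) (by fun_prop)
      rw [two_im, abs_lt]; constructor <;> linarith
    · have hst : DifferentiableAt ℂ (fun α => st b α) z := by simp only [st_eq]; fun_prop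
      have hD : DifferentiableAt ℂ (fun a => Dfun b ε a y) (st b z) :=
        D_diff_param h (by
          rw [st_im, abs_of_neg (show -((b + b⁻¹) / 2) - z.im < 0 by linarith)]; linarith)
      exact hD.comp z hst
  set m := min (-(b/2)) (-|y.im|) with hm
  have hm0 : -((b + b⁻¹) / 2) < m := lt_min (by linarith) (by linarith)
  have hm1 : m ≤ -(b/2) := min_le_left _ _
  have hm2 : m ≤ -|y.im| := min_le_right _ _
  set α1 : ℂ := Complex.I * (((-((b + b⁻¹) / 2) + m) / 2 : ℝ) : ℂ) with hα1
  have hi : α1.im = (-((b + b⁻¹) / 2) + m) / 2 := by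
    simp only [hα1, Complex.mul_im, Complex.I_re, Complex.I_im, Complex.ofReal_re, Complex.ofReal_im]; ring
  have h1 : α1 ∈ U := ⟨by rw [hi]; linarith, by rw [hi]; linarith⟩
  refine hA.eqOn_of_preconnected_of_eventuallyEq hB hUc.isPreconnected h1 ?_ (show α ∈ U from ⟨ha, hy⟩)
  have o3 : IsOpen {α : ℂ | α.im < -(b/2)} := isOpen_lt (by fun_prop) (by fun_prop)
  filter_upwards [hUo.mem_nhds h1, o3.mem_nhds (show α1 ∈ {α : ℂ | α.im < -(b/2)} by
    simp only [mem_setOf_eq]; rw [hi]; linarith)] with z hz hz2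
  exact hκ z hz.1 hz2 y hz.2

/-- realness -/
lemma D_real (h : Hyp b ε) (a x : ℝ) : ∃ r : ℝ, Dfun b ε (Complex.I * a) x = ((Real.exp r : ℝ) : ℂ) := by
  have hb' : (b:ℂ) ≠ 0 := by exact_mod_cast h.hb.ne'
  set f : ℂ → ℂ := fun T => Complex.cos (2 * T * x) * Complex.sin (2 * (Complex.I * a) * T) /
    (2 * T * Complex.sinh (b * T) * Complex.sinh (T / b)) with hf
  have hneg : ∀ T, f (-T) = f T := by
    intro T
    simp only [hf]
    rw [show 2 * -T * (x:ℂ) = -(2 * T * x) by ring, show 2 * (Complex.I * a) * -T = -(2 * (Complex.I * a) * T) by ring,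
      show (b:ℂ) * -T = -(b * T) by ring, neg_div, Complex.cos_neg, Complex.sin_neg, Complex.sinh_neg, Complex.sinh_neg]
    rw [← neg_div_neg_eq]
    congr 1 <;> ring
  have hconj : ∀ T, (starRingEnd ℂ) (Complex.I * f T) = Complex.I * f ((starRingEnd ℂ) T) := by
    intro T
    simp only [hf]
    simp only [map_mul, map_div₀, ← Complex.cos_conj, ← Complex.sin_conj, ← Complex.sinh_conj, Complex.conj_ofReal,
      Complex.conj_I, map_ofNat]
    rw [show 2 * (-Complex.I * (a:ℂ)) * (starRingEnd ℂ) T = -(2 * (Complex.I * a) * (starRingEnd ℂ) T) by ring,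
      Complex.sin_neg]
    ring
  have hr : (starRingEnd ℂ) (Complex.I * ∫ t : ℝ, f (t + Complex.I * ε)) = Complex.I * ∫ t : ℝ, f (t + Complex.I * ε) := by
    rw [← integral_const_mul, ← integral_conj, ← integral_neg_eq_self]
    refine integral_congr_ae (Eventually.of_forall fun t => ?_)
    simp only [hconj]
    rw [← hneg]
    congr 2
    simp [add_comm]
  obtain ⟨r, hr⟩ := Complex.conj_eq_iff_real.1 hr
  refine ⟨r, ?_⟩
  rw [Complex.ofReal_exp, ← hr]
  rfl

lemma FT_formula (h : Hyp b ε) {α : ℂ} (ha : -((b + b⁻¹) / 2) < α.im)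
    {y : ℂ} (hy : |y.im| < -α.im) : FT b ε α y = wb b ε (2 * α + iq b) * Dfun b ε (st b α) y := by
  obtain ⟨κ, hκ⟩ := FT_kappa h
  have hb := h.hb
  have hbi := inv_pos.2 hb
  suffices hk : κ = 1 by rw [hκ α ha y hy, hk, one_mul]
  set q := (b + b⁻¹) / 2 with hq
  have hq0 : 0 < q := by rw [hq]; positivity
  set α0 : ℂ := Complex.I * ((-(q/2) : ℝ) : ℂ) with hα0
  have hi : α0.im = -(q/2) := by
    simp only [hα0, Complex.mul_im, Complex.I_re, Complex.I_im, Complex.ofReal_re, Complex.ofReal_im]; ring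
  have hal : |α0.im| < q := by rw [hi, abs_neg, abs_of_pos (by positivity)]; linarith
  have e1 : 2 * α0 + iq b = 0 := by
    rw [hα0, iq, ← hq]; push_cast; ring
  have e2 : st b α0 = α0 := by rw [st_eq]; linear_combination -e1
  set f : ℝ → ℂ := fun x => Dfun b ε α0 x with hf
  have hF : ∀ y : ℝ, FT b ε α0 y = κ * f y := by
    intro y
    have := hκ α0 (by rw [hi]; linarith) y (by rw [hi]; simp; exact hq0)
    rwa [e1, e2, wb_zero h, mul_one] at this
  have hint : Integrable f := by
    have := gI_int0 h (α := α0) (y := 0) (by rw [hi]; linarith) (by rw [hi]; simp; exact hq0)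
    simpa [gI] using this
  have hcont : Continuous f := by
    have := gI_cont0 h (α := α0) 0 hal
    simpa [gI] using this
  have hFf : FourierTransform.fourier f = fun y => κ * f y := by
    ext y
    rw [Real.fourier_real_eq_integral_exp_smul]
    have e : FT b ε α0 (-(y:ℂ)) = κ * f y := by rw [FT_even h hal]; exact hF y
    rw [← e, FT]
    refine integral_congr_ae (Eventually.of_forall fun x => ?_)
    simp only [gI, hf, smul_eq_mul]
    congr 2; push_cast; ring
  have hinv : FourierTransformInv.fourierInv (fun y => κ * f y) = fun y => κ * (κ * f y) := by
    ext y
    rw [Real.fourierInv_eq']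
    have e : FT b ε α0 y = κ * f y := hF y
    rw [← e, FT, ← integral_const_mul]
    refine integral_congr_ae (Eventually.of_forall fun x => ?_)
    simp only [gI, hf, smul_eq_mul]
    rw [mul_left_comm]
    congr 3; simp; ring
  have h1 := hcont.fourierInv_fourier_eq hint (by rw [hFf]; exact hint.const_mul κ)
  rw [hFf, hinv] at h1
  have h2 := congrFun h1 0
  have hf0 : f 0 ≠ 0 := D_ne _ _
  have h3 : κ * κ = 1 := by
    refine mul_right_cancel₀ hf0 ?_
    rw [one_mul, mul_assoc]; exact h2
  have hre : ∀ x : ℝ, ∃ r : ℝ, f x = ((Real.exp r : ℝ) : ℂ) := fun x => D_real h _ x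
  choose r hr using hre
  have h4 : κ * f 0 = ∫ x : ℝ, f x := by
    have := hF 0
    rw [← this, FT]
    simp [gI, hf]
  rw [hr 0] at h4
  simp only [hr] at h4
  rw [integral_complex_ofReal] at h4
  have h5 : 0 ≤ ∫ x, Real.exp (r x) := integral_nonneg fun x => (Real.exp_pos _).le
  have h6 : 0 ≤ κ.re := by
    have := congrArg Complex.re h4
    simp only [Complex.re_mul_ofReal, Complex.ofReal_re] at this
    rw [← this] at h5
    exact nonneg_of_mul_nonneg_left h5 (Real.exp_pos _)
  rcases mul_self_eq_one_iff.1 h3 with h7 | h7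
  · exact h7
  · rw [h7] at h6; simp at h6; linarith

end QD

namespace QD
open Filter Topology Set
variable {b ε : ℝ}

lemma parseval {f g : ℝ → ℂ} (hf : Integrable f) (hg : Integrable g) (hgc : Continuous g)
    (hG : Integrable (FourierTransform.fourier g)) :
    Integrable (fun x => f x * g x) ∧
    ∫ x, f x * g x = ∫ y, FourierTransform.fourier f y * FourierTransform.fourier g (-y) := by
  have h1 := hgc.fourierInv_fourier_eq hg hG
  rw [Real.fourierInv_eq_fourier_comp_neg] at h1
  constructor
  · refine hf.mul_bdd (c := ∫ v, ‖FourierTransform.fourier g (-v)‖) hgc.aestronglyMeasurable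
      (Eventually.of_forall fun x => ?_)
    rw [← congrFun h1 x]
    exact VectorFourier.norm_fourierIntegral_le_integral_norm _ _ _ _ _
  · have h2 := VectorFourier.integral_fourierIntegral_smul_eq_flip (μ := volume) (ν := volume)
      (L := innerₗ ℝ) (f := f) (g := fun x => FourierTransform.fourier g (-x))
      Real.continuous_fourierChar continuous_inner hf hG.comp_neg
    rw [flip_innerₗ] at h2
    have h3 : ∀ x, VectorFourier.fourierIntegral Real.fourierChar volume (innerₗ ℝ)
      (fun x => FourierTransform.fourier g (-x)) x = g x := fun x => congrFun h1 x
    simp only [h3, smul_eq_mul] at h2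
    exact h2.symm

lemma shift_facts (h : Hyp b ε) {α p : ℂ} (ha : -((b + b⁻¹) / 2) < α.im) (hp : |p.im| < -α.im)
    (u : ℝ) : 
    Integrable (fun x : ℝ => Complex.exp (2 * Real.pi * Complex.I * p * x) * Dfun b ε α (x - u)) ∧
    Continuous (fun x : ℝ => Complex.exp (2 * Real.pi * Complex.I * p * x) * Dfun b ε α (x - u)) ∧
    ∀ y : ℝ, FourierTransform.fourier
      (fun x : ℝ => Complex.exp (2 * Real.pi * Complex.I * p * x) * Dfun b ε α (x - u)) y =
      Complex.exp (2 * Real.pi * Complex.I * u * (p - y)) *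
        (wb b ε (2 * α + iq b) * Dfun b ε (st b α) (p - y)) := by
  have h0 : α.im < 0 := by have := abs_nonneg p.im; linarith
  have hal : |α.im| < (b + b⁻¹) / 2 := by rw [abs_of_neg h0]; linarith
  have e : ∀ (p : ℂ) (x : ℝ), Complex.exp (2 * Real.pi * Complex.I * p * x) * Dfun b ε α (x - u) =
      Complex.exp (2 * Real.pi * Complex.I * u * p) * gI b ε α p ((x - u : ℝ) : ℂ) := by
    intro p x
    rw [gI, ← mul_assoc, ← Complex.exp_add]
    push_cast
    congr 2; ring
  refine ⟨?_, ?_, fun y => ?_⟩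
  · simp only [e]
    exact ((gI_int0 h ha hp).comp_sub_right u).const_mul _
  · simp only [e]
    exact continuous_const.mul ((gI_cont0 h p hal).comp (continuous_id.sub continuous_const))
  · rw [Real.fourier_real_eq_integral_exp_smul, ← FT_formula h ha (by simpa using hp), FT,
      ← integral_const_mul,
      ← integral_sub_right_eq_self (fun x : ℝ => Complex.exp (2 * Real.pi * Complex.I * u * (p - y)) * gI b ε α (p - y) x) u]
    refine integral_congr_ae (Eventually.of_forall fun x => ?_)
    simp only [smul_eq_mul]
    rw [← e, ← mul_assoc, ← Complex.exp_add]
    congr 2; push_cast; ring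

lemma D_prod (h : Hyp b ε) {p r : ℂ} (hp : p.im < 0) (hr : r.im < 0)
    (hpr : -((b + b⁻¹) / 2) < p.im + r.im) (y : ℝ) :
    Dfun b ε p (r - y) * Dfun b ε r (p + y) = Dfun b ε (p + r) y := by
  have hb := h.hb
  have hbi := inv_pos.2 hb
  rw [Dfun_wb h (by simp [abs_of_neg hp, abs_of_neg hr]; linarith),
    Dfun_wb h (by simp [abs_of_neg hp, abs_of_neg hr]; linarith),
    Dfun_wb h (by simp [abs_of_neg (add_neg hp hr)]; linarith)]
  have h1 := wb_mul_neg h (z := p - (r - y)) (by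
    simp only [Complex.sub_im, Complex.ofReal_im, sub_zero]
    rw [abs_lt]; constructor <;> linarith)
  rw [show p + (r - (y:ℂ)) = p + r - y by ring, show r + (p + (y:ℂ)) = p + r + y by ring,
    show r - (p + (y:ℂ)) = -(p - (r - y)) by ring]
  linear_combination (wb b ε (p + r - y) * wb b ε (p + r + y)) * h1

lemma Dint (h : Hyp b ε) {p r : ℂ} (hp : p.im < 0) (hr : r.im < 0)
    (hpr : -((b + b⁻¹) / 2) < p.im + r.im) (v : ℝ) (C : ℂ) {F : ℝ → ℂ}
    (hF : AEStronglyMeasurable F) 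
    (hFe : ∀ y : ℝ, F y = Complex.exp (2 * Real.pi * Complex.I * v * (p - y)) * (C * Dfun b ε r (p - y))) :
    Integrable F := by
  obtain ⟨K, hK, hB⟩ := D_bound' h (m := -(p.im + r.im)) (by linarith) r
  have hi := ((integrable_exp_neg_abs (c := 2 * Real.pi * (-r.im))
    (mul_pos Real.two_pi_pos (by linarith))).comp_sub_left p.re).const_mul 
    (Real.exp (-(2 * Real.pi * (v * p.im))) * ‖C‖ * K)
  refine hi.mono' hF (Eventually.of_forall fun y => ?_)
  rw [hFe, norm_mul, norm_mul, norm_kernel]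
  have h1 := hB (p - y) (by simp [abs_of_neg hp, abs_of_neg hr])
  simp only [Complex.sub_re, Complex.sub_im, Complex.ofReal_re, Complex.ofReal_im, sub_zero, zero_mul, add_zero] at h1 ⊢
  rw [show -(2 * Real.pi * (-r.im) * |p.re - y|) = 2 * Real.pi * r.im * |p.re - y| by ring,
    mul_assoc (_ * ‖C‖), mul_assoc _ ‖C‖]
  gcongr

end QD

/-- A two-factor integral identity for `D`-functions
(summation formula `(D21)` of the paper). -/
theorem Dfun_two_factor_identity (b ε : ℝ) (hb : 0 < b) (hε0 : 0 < ε)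
    (hε : ε < Real.pi * min b b⁻¹) (α β : ℂ)
    (hα1 : -((b + b⁻¹) / 2) < α.im) (hα2 : α.im < 0)
    (hβ1 : -((b + b⁻¹) / 2) < β.im) (hβ2 : β.im < 0)
    (hαβ : (α + β).im < -((b + b⁻¹) / 2)) (u v : ℝ) :
    Integrable (fun x : ℝ =>
        Complex.exp (2 * ((Real.pi : ℝ) : ℂ) * Complex.I *
            ((-(Complex.I * (((b + b⁻¹) / 2 : ℝ) : ℂ)) - α) +
              (-(Complex.I * (((b + b⁻¹) / 2 : ℝ) : ℂ)) - β)) * (x : ℂ)) *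
          Dfun b ε α ((x : ℂ) - (u : ℂ)) * Dfun b ε β ((x : ℂ) - (v : ℂ))) ∧
      ∫ x : ℝ,
          Complex.exp (2 * ((Real.pi : ℝ) : ℂ) * Complex.I *
              ((-(Complex.I * (((b + b⁻¹) / 2 : ℝ) : ℂ)) - α) +
                (-(Complex.I * (((b + b⁻¹) / 2 : ℝ) : ℂ)) - β)) * (x : ℂ)) *
            Dfun b ε α ((x : ℂ) - (u : ℂ)) * Dfun b ε β ((x : ℂ) - (v : ℂ)) =
        wb b ε (2 * α + Complex.I * (((b + b⁻¹) / 2 : ℝ) : ℂ)) *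
          wb b ε (2 * β + Complex.I * (((b + b⁻¹) / 2 : ℝ) : ℂ)) *
          wb b ε (-(2 * (α + β)) - 3 * Complex.I * (((b + b⁻¹) / 2 : ℝ) : ℂ)) *
          Complex.exp (2 * ((Real.pi : ℝ) : ℂ) * Complex.I *
            ((v : ℂ) * (-(Complex.I * (((b + b⁻¹) / 2 : ℝ) : ℂ)) - α) +
              (u : ℂ) * (-(Complex.I * (((b + b⁻¹) / 2 : ℝ) : ℂ)) - β))) *
          Dfun b ε (α + β + Complex.I * (((b + b⁻¹) / 2 : ℝ) : ℂ)) ((u : ℂ) - (v : ℂ)) := by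
  have h := QD.Hyp.mk' hb hε0 hε
  rw [Complex.add_im] at hαβ
  have hα' := QD.st_im (b := b) α
  have hβ' := QD.st_im (b := b) β
  have eα : -(Complex.I * (((b + b⁻¹) / 2 : ℝ) : ℂ)) - α = QD.st b α := rfl
  have eβ : -(Complex.I * (((b + b⁻¹) / 2 : ℝ) : ℂ)) - β = QD.st b β := rfl
  have e1 : -(2 * (α + β)) - 3 * Complex.I * (((b + b⁻¹) / 2 : ℝ) : ℂ) =
      2 * (QD.st b α + QD.st b β) + QD.iq b := by
    rw [← eα, ← eβ, QD.iq]; ring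
  have e2 : α + β + Complex.I * (((b + b⁻¹) / 2 : ℝ) : ℂ) = QD.st b (QD.st b α + QD.st b β) := by
    rw [QD.st_eq (QD.st b α + QD.st b β), ← eα, ← eβ, QD.iq]; ring
  have e3 : Complex.I * (((b + b⁻¹) / 2 : ℝ) : ℂ) = QD.iq b := rfl
  simp only [eα, eβ, e1, e2]
  simp only [e3]
  clear e1 e2 e3 eα eβ
  set p := QD.st b α with hp
  set r := QD.st b β with hr
  have hp0 : p.im < 0 := by linarith
  have hr0 : r.im < 0 := by linarith
  have hpr : -((b + b⁻¹) / 2) < p.im + r.im := by linarith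
  obtain ⟨f1, -, f3⟩ := QD.shift_facts h (α := α) (p := r) hα1 (by rw [abs_of_neg hr0]; linarith) u
  obtain ⟨g1, g2, g3⟩ := QD.shift_facts h (α := β) (p := p) hβ1 (by rw [abs_of_neg hp0]; linarith) v
  have hG := QD.Dint h hp0 hr0 hpr v _
    (VectorFourier.fourierIntegral_continuous (L := innerₗ ℝ) Real.continuous_fourierChar
      continuous_inner g1).aestronglyMeasurable g3
  obtain ⟨P1, P2⟩ := QD.parseval f1 g1 g2 hG
  have e : ∀ x : ℝ, Complex.exp (2 * Real.pi * Complex.I * (p + r) * x) *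
      Dfun b ε α (x - u) * Dfun b ε β (x - v) =
      (Complex.exp (2 * Real.pi * Complex.I * r * x) * Dfun b ε α (x - u)) *
      (Complex.exp (2 * Real.pi * Complex.I * p * x) * Dfun b ε β (x - v)) := by
    intro x
    rw [show 2 * Real.pi * Complex.I * (p + r) * x = 2 * Real.pi * Complex.I * r * x + 
      2 * Real.pi * Complex.I * p * x by ring, Complex.exp_add]
    ring
  simp only [e]
  refine ⟨P1, ?_⟩
  rw [P2]
  have hFT := QD.FT_formula h (α := p + r) (y := ((v - u : ℝ) : ℂ)) (by simpa using hpr)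
    (by simp; linarith)
  have hev : Dfun b ε (QD.st b (p + r)) ((u:ℂ) - v) =
      Dfun b ε (QD.st b (p + r)) ((v - u : ℝ) : ℂ) := by
    rw [← QD.D_even h]
    · congr 1; push_cast; ring
    · rw [QD.st_im, Complex.sub_im, Complex.ofReal_im, Complex.ofReal_im, sub_zero, abs_zero, zero_add, Complex.add_im,
        abs_of_neg (by linarith)]
      linarith
  rw [hev]
  have : ∀ a1 a2 a3 a4 a5 : ℂ, a1 * a2 * a3 * a4 * a5 = (a1 * a2 * a4) * (a3 * a5) := by
    intros; ring
  rw [this, ← hFT, QD.FT, ← integral_const_mul]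
  refine integral_congr_ae (Filter.Eventually.of_forall fun y => ?_)
  simp only [f3, g3]
  rw [QD.gI, ← QD.D_prod h hp0 hr0 hpr y]
  have e4 : Complex.exp (2 * Real.pi * Complex.I * u * (r - y)) *
      Complex.exp (2 * Real.pi * Complex.I * v * (p - ((-y : ℝ) : ℂ))) =
      Complex.exp (2 * Real.pi * Complex.I * (v * p + u * r)) *
      Complex.exp (2 * Real.pi * Complex.I * y * ((v - u : ℝ) : ℂ)) := by
    rw [← Complex.exp_add, ← Complex.exp_add]
    congr 1; push_cast; ring
  rw [show p - ((-y : ℝ) : ℂ) = p + y by push_cast; ring] at e4 ⊢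
  linear_combination (wb b ε (2 * α + QD.iq b) * Dfun b ε p (r - y) *
    (wb b ε (2 * β + QD.iq b) * Dfun b ε r (p + y))) * e4
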